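/- arXiv:2404.13689 — 4 statements merged into one kernel-verified Lean document; each statement's English description precedes it below -/
import Mathlib

section
/- For the complex conjugate root pair λ_{1,2}(μ) = −(1/2)μ^{β−2α}(1 + o(1)) ± i μ^{α}(1 + o(1)) as μ → ∞ (with α > (β+1)/2, α, β ∈ [0,1]), one has |Re λ_i(μ)| = (1/2)|Im λ_i(μ)|^{-k}(1 + o(1)) with k = (2α − β)/α; in particular k ≥ 1 and the spectral abscissa of this family tends to 0 at exactly the polynomial rate |Im λ|^{-(2α−β)/α}. -/
open Complex Filter

noncomputable section

/-- A function within relative error `ε` of a positive comparison has quotient tending to one. -/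
lemma tendsto_ratio_one (f g : ℝ → ℝ) (hg : ∀ μ : ℝ, 0 < μ → 0 < g μ)
    (h : ∀ ε > (0:ℝ), ∃ M : ℝ, ∀ μ : ℝ, M < μ → |f μ - g μ| ≤ ε * g μ) :
    Tendsto (fun μ => f μ / g μ) atTop (nhds 1) := by
  rw [Metric.tendsto_atTop]
  intro ε hε
  obtain ⟨M, hM⟩ := h (ε / 2) (half_pos hε)
  refine ⟨max M 0 + 1, fun μ hμ => ?_⟩
  have h1 : M < μ := by linarith [le_max_left M 0]
  have h2 : 0 < μ := by linarith [le_max_right M 0]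
  have hp := hg μ h2
  have h3 := hM μ h1
  have h4 : f μ / g μ - 1 = (f μ - g μ) / g μ := by field_simp
  rw [Real.dist_eq, h4, abs_div, abs_of_pos hp, div_lt_iff₀ hp]
  nlinarith

/-- For the complex conjugate root pair
`λ(μ) = −(1/2)μ^{β−2α}(1+o(1)) ± iμ^α(1+o(1))` of the characteristic quartic
(as `μ → ∞`, `α > (β+1)/2`, `α, β ∈ [0,1]`), one has
`|Re λ(μ)| = (1/2)|Im λ(μ)|^{−k}(1+o(1))` with `k = (2α−β)/α`; in particular
`k ≥ 1`, so the spectral abscissa of this family tends to `0` at exactly the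
polynomial rate `|Im λ|^{−(2α−β)/α}`. -/
theorem root_pair_exponent_relation (α β : ℝ)
    (hα : α ∈ Set.Icc (0:ℝ) 1) (hβ : β ∈ Set.Icc (0:ℝ) 1) (hQ : (β + 1) / 2 < α)
    (lam : ℝ → ℂ)
    -- `Re λ(μ) = −(1/2)μ^{β−2α}(1+o(1))`
    (hre : ∀ ε > (0:ℝ), ∃ M : ℝ, ∀ μ : ℝ, M < μ →
      |(lam μ).re - (-(1 / 2) * μ ^ (β - 2 * α))| ≤ ε * ((1 / 2) * μ ^ (β - 2 * α)))
    -- `Im λ(μ) = ±μ^α(1+o(1))`; take the branch `Im λ(μ) = μ^α(1+o(1))`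
    (him : ∀ ε > (0:ℝ), ∃ M : ℝ, ∀ μ : ℝ, M < μ → |(lam μ).im - μ ^ α| ≤ ε * μ ^ α) :
    1 ≤ (2 * α - β) / α ∧
    Tendsto (fun μ : ℝ => |(lam μ).re| / ((1 / 2) * |(lam μ).im| ^ (-((2 * α - β) / α))))
      atTop (nhds 1) := by
  obtain ⟨hβ0, hβ1⟩ := hβ
  have hα0 : 0 < α := by linarith
  refine ⟨by rw [le_div_iff₀ hα0]; linarith, ?_⟩
  have ha := tendsto_ratio_one (fun μ => -(lam μ).re) (fun μ => (1 / 2) * μ ^ (β - 2 * α))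
    (fun μ hμ => by positivity) (fun ε hε => by
      obtain ⟨M, hM⟩ := hre ε hε
      refine ⟨M, fun μ hμ => ?_⟩
      have h := hM μ hμ
      rw [← abs_neg] at h
      convert h using 2
      ring)
  have hb := tendsto_ratio_one (fun μ => (lam μ).im) (fun μ => μ ^ α)
    (fun μ hμ => by positivity) him
  set k := (2 * α - β) / α with hk
  have hkα : α * (-k) = β - 2 * α := by rw [hk]; field_simp; ring
  have hb' : Tendsto (fun μ : ℝ => |(lam μ).im / μ ^ α| ^ (-k)) atTop (nhds 1) := by
    have := hb.abs.rpow_const (p := -k) (Or.inl (by norm_num))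
    simpa using this
  have hq := ha.abs.div hb' one_ne_zero
  simp only [abs_one, div_one] at hq
  refine hq.congr' ?_
  filter_upwards [eventually_gt_atTop 0] with μ hμ
  have hp : 0 < μ ^ (β - 2 * α) := by positivity
  have hpα : 0 < μ ^ α := by positivity
  simp only [Pi.div_apply]
  rw [abs_div, abs_div, abs_neg, abs_of_pos hpα, abs_of_pos (by positivity : 0 < 1 / 2 * μ ^ (β - 2 * α)),
    Real.div_rpow (abs_nonneg _) hpα.le, ← Real.rpow_mul hμ.le, hkα]
  field_simp
end
end

section
/- Let A be self-adjoint positive definite with compact resolvent, and let 𝒜 be the thermoelastic generator with m > 0, σ > 0, τ > 0, (α, β, γ) ∈ [0,1]² × (0,1], α > (β+1)/2. Then every nonzero purely imaginary number iλ (λ ∈ ℝ \ {0}) belongs to the resolvent set of 𝒜; i.e., σ(𝒜) ∩ iℝ = {0}. -/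
open Filter Complex

noncomputable section

/-- State space element: four coefficient sequences `(u, v, θ, q)` w.r.t. the
orthonormal eigenbasis of `A`. -/
abbrev ThermoSt := (ℕ → ℂ) × (ℕ → ℂ) × (ℕ → ℂ) × (ℕ → ℂ)

/-- Summand of the squared `ℋ`-norm:
`σ‖A^{1/2}u‖² + m‖A^{γ/2}v‖² + ‖v‖² + ‖θ‖² + τ‖q‖²` written spectrally. -/
def thermoSummand (μ : ℕ → ℝ) (m σ τ γ : ℝ) (U : ThermoSt) (n : ℕ) : ℝ :=
  σ * μ n * ‖U.1 n‖ ^ 2 + m * μ n ^ γ * ‖U.2.1 n‖ ^ 2 + ‖U.2.1 n‖ ^ 2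
    + ‖U.2.2.1 n‖ ^ 2 + τ * ‖U.2.2.2 n‖ ^ 2

/-- Membership in the state space `ℋ = D(A^{1/2}) × D(A^{γ/2}) × H × H`. -/
def thermoMemH (μ : ℕ → ℝ) (m σ τ γ : ℝ) (U : ThermoSt) : Prop :=
  Summable (thermoSummand μ m σ τ γ U)

/-- The squared `ℋ`-norm. -/
def thermoNormSq (μ : ℕ → ℝ) (m σ τ γ : ℝ) (U : ThermoSt) : ℝ :=
  ∑' n, thermoSummand μ m σ τ γ U n

/-- The `ℋ`-inner product. -/
def thermoInner (μ : ℕ → ℝ) (m σ τ γ : ℝ) (U V : ThermoSt) : ℂ :=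
  ∑' n, (((σ * μ n : ℝ) : ℂ) * (starRingEnd ℂ (U.1 n)) * V.1 n
      + ((m * μ n ^ γ : ℝ) : ℂ) * (starRingEnd ℂ (U.2.1 n)) * V.2.1 n
      + (starRingEnd ℂ (U.2.1 n)) * V.2.1 n
      + (starRingEnd ℂ (U.2.2.1 n)) * V.2.2.1 n
      + ((τ : ℝ) : ℂ) * (starRingEnd ℂ (U.2.2.2 n)) * V.2.2.2 n)

/-- The thermoelastic operator `𝒜`, acting diagonally on eigenspaces of `A`:
`𝒜(u,v,θ,q) = (v, −(I+mA^γ)⁻¹(σAu − A^αθ), −A^αv + A^{β/2}q, τ⁻¹(−q − A^{β/2}θ))`. -/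
def thermoOp (μ : ℕ → ℝ) (m σ τ α β γ : ℝ) (U : ThermoSt) : ThermoSt :=
  (U.2.1,
   fun n => -(((1 + m * μ n ^ γ : ℝ) : ℂ))⁻¹ *
      (((σ * μ n : ℝ) : ℂ) * U.1 n - ((μ n ^ α : ℝ) : ℂ) * U.2.2.1 n),
   fun n => -((μ n ^ α : ℝ) : ℂ) * U.2.1 n + ((μ n ^ (β / 2) : ℝ) : ℂ) * U.2.2.2 n,
   fun n => ((τ : ℝ) : ℂ)⁻¹ *
      (-(U.2.2.2 n) - ((μ n ^ (β / 2) : ℝ) : ℂ) * U.2.2.1 n))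

/-- The (maximal) domain of `𝒜`:  `U ∈ ℋ`, `𝒜U ∈ ℋ`, `v ∈ D(A^{1/2})`,
`σAu − A^αθ ∈ D(A^{−γ/2})`, `−A^αv + A^{β/2}q ∈ H`, `q + A^{β/2}θ ∈ H`. -/
def thermoDom (μ : ℕ → ℝ) (m σ τ α β γ : ℝ) (U : ThermoSt) : Prop :=
  thermoMemH μ m σ τ γ U ∧ thermoMemH μ m σ τ γ (thermoOp μ m σ τ α β γ U) ∧
  Summable (fun n => μ n * ‖U.2.1 n‖ ^ 2) ∧
  Summable (fun n => μ n ^ (-γ) *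
    ‖((σ * μ n : ℝ) : ℂ) * U.1 n - ((μ n ^ α : ℝ) : ℂ) * U.2.2.1 n‖ ^ 2) ∧
  Summable (fun n => ‖-((μ n ^ α : ℝ) : ℂ) * U.2.1 n + ((μ n ^ (β / 2) : ℝ) : ℂ) * U.2.2.2 n‖ ^ 2) ∧
  Summable (fun n => ‖U.2.2.2 n + ((μ n ^ (β / 2) : ℝ) : ℂ) * U.2.2.1 n‖ ^ 2)

/-- Real and imaginary part expansion of the dissipation identity on one mode. -/
lemma mode_dissip (y p a b m σ τ l : ℝ) (hτ : 0 < τ) (hd : 0 < 1 + m * p)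
    (u v t q g1 g2 g3 g4 : ℂ)
    (e1 : I * (l : ℂ) * u - v = g1)
    (e2 : I * (l : ℂ) * v - (-(((1 + m * p : ℝ) : ℂ))⁻¹ *
      (((σ * y : ℝ) : ℂ) * u - (a : ℂ) * t)) = g2)
    (e3 : I * (l : ℂ) * t - (-(a : ℂ) * v + (b : ℂ) * q) = g3)
    (e4 : I * (l : ℂ) * q - (((τ : ℝ) : ℂ)⁻¹ * (-q - (b : ℂ) * t)) = g4) :
    ‖q‖ ^ 2 = σ * y * (u.re * g1.re + u.im * g1.im) + (1 + m * p) * (v.re * g2.re + v.im * g2.im)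
      + (t.re * g3.re + t.im * g3.im) + τ * (q.re * g4.re + q.im * g4.im) := by
  have hdc : (((1 + m * p : ℝ) : ℂ)) ≠ 0 := by exact_mod_cast hd.ne'
  have hτc : (τ : ℂ) ≠ 0 := by exact_mod_cast hτ.ne'
  have e2' : ((1 + m * p : ℝ) : ℂ) * (I * (l : ℂ) * v) + (((σ * y : ℝ) : ℂ) * u - (a : ℂ) * t)
      = ((1 + m * p : ℝ) : ℂ) * g2 := by
    rw [← e2]; field_simp; ring
  have e4' : (τ : ℂ) * (I * (l : ℂ) * q) + q + (b : ℂ) * t = (τ : ℂ) * g4 := by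
    rw [← e4]; field_simp; ring
  generalize 1 + m * p = d at *
  have r1 := congrArg re e1
  have i1 := congrArg im e1
  have r2 := congrArg re e2'
  have i2 := congrArg im e2'
  have r3 := congrArg re e3
  have i3 := congrArg im e3
  have r4 := congrArg re e4'
  have i4 := congrArg im e4'
  simp at r1 i1 r2 i2 r3 i3 r4 i4
  rw [← normSq_eq_norm_sq, normSq_apply]
  linear_combination (-1) * (σ * y * (u.re * -r1 + u.im * -i1)) + (v.re * r2 + v.im * i2)
    + (t.re * r3 + t.im * i3) + (q.re * r4 + q.im * i4)

lemma young_aux (e : ℝ) (he : 0 < e) (z w : ℂ) :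
    z.re * w.re + z.im * w.im ≤ e * ‖z‖ ^ 2 + e⁻¹ * ‖w‖ ^ 2 := by
  rw [← normSq_eq_norm_sq, ← normSq_eq_norm_sq, normSq_apply, normSq_apply]
  have key : ∀ x y : ℝ, x * y ≤ e * (x * x) + e⁻¹ * (y * y) := by
    intro x y
    have h : 0 ≤ e⁻¹ * ((e * x - y / 2) ^ 2 + 3 / 4 * y ^ 2) := by positivity
    have h2 : e⁻¹ * ((e * x - y / 2) ^ 2 + 3 / 4 * y ^ 2)
      = e * (x * x) + e⁻¹ * (y * y) - x * y := by field_simp; ring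
    linarith
  linarith [key z.re w.re, key z.im w.im]

lemma norm_sq_add2 (z w : ℂ) : ‖z + w‖ ^ 2 ≤ 2 * (‖z‖ ^ 2 + ‖w‖ ^ 2) := by
  have := norm_add_le z w
  nlinarith [norm_nonneg z, norm_nonneg w, norm_nonneg (z + w), sq_nonneg (‖z‖ - ‖w‖)]

set_option maxHeartbeats 1000000 in
/-- Uniform one-mode estimate. -/
lemma mode_bound (m σ τ l K : ℝ) (hm : 0 < m) (hσ : 0 < σ) (hτ : 0 < τ) (hl : l ≠ 0)
    (hK : 0 < K) :
    ∃ C > (0:ℝ), ∀ y p a b : ℝ, 0 < y → 0 < p → 0 < a → 0 < b → p ≤ K * y → 1 ≤ K * y →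
      1 ≤ K * b ^ 2 → y ≤ K * a ^ 2 → y * b ^ 2 ≤ K * a ^ 2 →
      ∀ u v t q g1 g2 g3 g4 : ℂ,
      I * (l : ℂ) * u - v = g1 →
      I * (l : ℂ) * v - (-(((1 + m * p : ℝ) : ℂ))⁻¹ *
        (((σ * y : ℝ) : ℂ) * u - (a : ℂ) * t)) = g2 →
      I * (l : ℂ) * t - (-(a : ℂ) * v + (b : ℂ) * q) = g3 →
      I * (l : ℂ) * q - (((τ : ℝ) : ℂ)⁻¹ * (-q - (b : ℂ) * t)) = g4 →
      σ * y * ‖u‖ ^ 2 + m * p * ‖v‖ ^ 2 + ‖v‖ ^ 2 + ‖t‖ ^ 2 + τ * ‖q‖ ^ 2 ≤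
        C * (σ * y * ‖g1‖ ^ 2 + m * p * ‖g2‖ ^ 2 + ‖g2‖ ^ 2 + ‖g3‖ ^ 2 + τ * ‖g4‖ ^ 2) := by
  have hl2 : 0 < l ^ 2 := by positivity
  obtain ⟨T, hTd⟩ : ∃ T, T = K * (2 * (1 + 2 * (l ^ 2 * τ ^ 2 + 1) + τ)) := ⟨_, rfl⟩
  have hT : 0 < T := by rw [hTd]; positivity
  obtain ⟨V, hVd⟩ : ∃ V, V = K * (4 * (1 + l ^ 2 * T + 1)) := ⟨_, rfl⟩
  have hV : 0 < V := by rw [hVd]; positivity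
  obtain ⟨D, hDd⟩ : ∃ D, D = 2 / l ^ 2 * (σ * V + 1) + (m * K + K) * V + T + τ := ⟨_, rfl⟩
  have hD : 0 < D := by rw [hDd]; positivity
  refine ⟨2 * (D + D * (2 * D)), by positivity, ?_⟩
  intro y p a b hy hp ha hb h1 h2 h3 h4 h5 u v t q g1 g2 g3 g4 e1 e2 e3 e4
  have hdis := mode_dissip y p a b m σ τ l hτ (by positivity) u v t q g1 g2 g3 g4 e1 e2 e3 e4
  obtain ⟨X, hX⟩ : ∃ X, X = σ * y * ‖u‖ ^ 2 + m * p * ‖v‖ ^ 2 + ‖v‖ ^ 2 + ‖t‖ ^ 2 + τ * ‖q‖ ^ 2 :=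
    ⟨_, rfl⟩
  obtain ⟨Y, hY⟩ : ∃ Y, Y = σ * y * ‖g1‖ ^ 2 + m * p * ‖g2‖ ^ 2 + ‖g2‖ ^ 2 + ‖g3‖ ^ 2
    + τ * ‖g4‖ ^ 2 := ⟨_, rfl⟩
  rw [← hX, ← hY]
  have n1 : 0 ≤ σ * y * ‖g1‖ ^ 2 := by positivity
  have n2 : 0 ≤ m * p * ‖g2‖ ^ 2 := by positivity
  have n2' : 0 ≤ ‖g2‖ ^ 2 := by positivity
  have n3 : 0 ≤ ‖g3‖ ^ 2 := by positivity
  have n4 : 0 ≤ τ * ‖g4‖ ^ 2 := by positivity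
  have hq0 : 0 ≤ ‖q‖ ^ 2 := by positivity
  have hY0 : 0 ≤ Y := by rw [hY]; positivity
  have hq : ‖q‖ ^ 2 ≤ (2 * D)⁻¹ * X + (2 * D) * Y := by
    have he : 0 < (2 * D)⁻¹ := by positivity
    have k := young_aux _ he
    rw [inv_inv] at k
    have k1 := mul_le_mul_of_nonneg_left (k u g1) (by positivity : 0 ≤ σ * y)
    have k2 := mul_le_mul_of_nonneg_left (k v g2) (by positivity : 0 ≤ 1 + m * p)
    have k3 := k t g3
    have k4 := mul_le_mul_of_nonneg_left (k q g4) hτ.le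
    rw [hdis, hX, hY]
    linarith
  have hτc : (τ : ℂ) ≠ 0 := by exact_mod_cast hτ.ne'
  have ht : ‖t‖ ^ 2 ≤ T * (‖q‖ ^ 2 + Y) := by
    have e : (b : ℂ) * t = (τ : ℂ) * g4 + -((I * ((l * τ : ℝ) : ℂ) * q) + q) := by
      rw [← e4]; push_cast; field_simp; ring
    have f := norm_sq_add2 ((τ : ℂ) * g4) (-((I * ((l * τ : ℝ) : ℂ) * q) + q))
    have f2 := norm_sq_add2 (I * ((l * τ : ℝ) : ℂ) * q) q
    rw [← e, norm_neg] at f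
    simp only [norm_mul, mul_pow, norm_real, norm_I, Real.norm_eq_abs, sq_abs, one_pow, one_mul] at f f2
    have g4Y : τ ^ 2 * ‖g4‖ ^ 2 ≤ τ * Y := by
      have : τ * ‖g4‖ ^ 2 ≤ Y := by rw [hY]; linarith
      have := mul_le_mul_of_nonneg_left this hτ.le
      linarith
    have s : b ^ 2 * ‖t‖ ^ 2 ≤ 2 * (1 + 2 * (l ^ 2 * τ ^ 2 + 1) + τ) * (‖q‖ ^ 2 + Y) := by
      have : 0 ≤ (2 * (1 + 2 * (l ^ 2 * τ ^ 2 + 1))) * Y := by positivity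
      have : 0 ≤ (2 * (1 + τ)) * ‖q‖ ^ 2 := by positivity
      linarith
    calc ‖t‖ ^ 2 ≤ (K * b ^ 2) * ‖t‖ ^ 2 := le_mul_of_one_le_left (by positivity) h3
      _ = K * (b ^ 2 * ‖t‖ ^ 2) := by ring
      _ ≤ K * _ := mul_le_mul_of_nonneg_left s hK.le
      _ = _ := by rw [hTd]; ring
  have hv : y * ‖v‖ ^ 2 ≤ V * (‖q‖ ^ 2 + Y) := by
    have e : (a : ℂ) * v = g3 + (-(I * (l : ℂ) * t) + (b : ℂ) * q) := by
      rw [← e3]; ring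
    have f := norm_sq_add2 g3 (-(I * (l : ℂ) * t) + (b : ℂ) * q)
    have f2 := norm_sq_add2 (-(I * (l : ℂ) * t)) ((b : ℂ) * q)
    rw [← e] at f
    simp only [norm_neg, norm_mul, mul_pow, norm_real, norm_I, Real.norm_eq_abs, sq_abs, one_pow, one_mul] at f f2
    have f3 : a ^ 2 * ‖v‖ ^ 2 ≤ 4 * (‖g3‖ ^ 2 + l ^ 2 * ‖t‖ ^ 2 + b ^ 2 * ‖q‖ ^ 2) := by linarith
    have g3Y : ‖g3‖ ^ 2 ≤ Y := by rw [hY]; linarith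
    have s1 : y * (a ^ 2 * ‖v‖ ^ 2) ≤ a ^ 2 * (V * (‖q‖ ^ 2 + Y)) := by
      calc y * (a ^ 2 * ‖v‖ ^ 2) ≤ y * (4 * (‖g3‖ ^ 2 + l ^ 2 * ‖t‖ ^ 2 + b ^ 2 * ‖q‖ ^ 2)) :=
            mul_le_mul_of_nonneg_left f3 hy.le
        _ = 4 * (y * (‖g3‖ ^ 2 + l ^ 2 * ‖t‖ ^ 2) + (y * b ^ 2) * ‖q‖ ^ 2) := by ring
        _ ≤ 4 * ((K * a ^ 2) * (‖g3‖ ^ 2 + l ^ 2 * ‖t‖ ^ 2) + (K * a ^ 2) * ‖q‖ ^ 2) := by gcongr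
        _ = (4 * K * a ^ 2) * (‖g3‖ ^ 2 + l ^ 2 * ‖t‖ ^ 2 + ‖q‖ ^ 2) := by ring
        _ ≤ (4 * K * a ^ 2) * ((‖q‖ ^ 2 + Y) + l ^ 2 * (T * (‖q‖ ^ 2 + Y)) + (‖q‖ ^ 2 + Y)) := by
            gcongr <;> linarith
        _ = _ := by rw [hVd]; ring
    have ha2 : 0 < a ^ 2 := by positivity
    refine le_of_mul_le_mul_left ?_ ha2
    linarith
  have hu : σ * y * ‖u‖ ^ 2 ≤ 2 / l ^ 2 * (σ * V + 1) * (‖q‖ ^ 2 + Y) := by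
    have e : I * (l : ℂ) * u = v + g1 := by rw [← e1]; ring
    have f := norm_sq_add2 v g1
    rw [← e] at f
    simp only [norm_neg, norm_mul, mul_pow, norm_real, norm_I, Real.norm_eq_abs, sq_abs, one_pow, one_mul] at f
    have g1Y : σ * y * ‖g1‖ ^ 2 ≤ Y := by rw [hY]; linarith
    have s : l ^ 2 * (σ * y * ‖u‖ ^ 2) ≤ 2 * (σ * V + 1) * (‖q‖ ^ 2 + Y) := by
      calc l ^ 2 * (σ * y * ‖u‖ ^ 2) = σ * y * (l ^ 2 * ‖u‖ ^ 2) := by ring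
        _ ≤ σ * y * (2 * (‖v‖ ^ 2 + ‖g1‖ ^ 2)) := by gcongr
        _ = 2 * (σ * (y * ‖v‖ ^ 2) + σ * y * ‖g1‖ ^ 2) := by ring
        _ ≤ 2 * (σ * (V * (‖q‖ ^ 2 + Y)) + (‖q‖ ^ 2 + Y)) := by gcongr; linarith
        _ = _ := by ring
    have : 2 / l ^ 2 * (σ * V + 1) * (‖q‖ ^ 2 + Y)
      = (2 * (σ * V + 1) * (‖q‖ ^ 2 + Y)) / l ^ 2 := by ring
    rw [this, le_div_iff₀ hl2]; linarith
  have hv2 : m * p * ‖v‖ ^ 2 + ‖v‖ ^ 2 ≤ (m * K + K) * V * (‖q‖ ^ 2 + Y) := by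
    calc m * p * ‖v‖ ^ 2 + ‖v‖ ^ 2 = m * p * ‖v‖ ^ 2 + 1 * ‖v‖ ^ 2 := by ring
      _ ≤ m * (K * y) * ‖v‖ ^ 2 + (K * y) * ‖v‖ ^ 2 := by gcongr
      _ = (m * K + K) * (y * ‖v‖ ^ 2) := by ring
      _ ≤ (m * K + K) * (V * (‖q‖ ^ 2 + Y)) := by gcongr
      _ = _ := by ring
  have hXD : X ≤ D * (‖q‖ ^ 2 + Y) := by
    have : τ * ‖q‖ ^ 2 ≤ τ * (‖q‖ ^ 2 + Y) := by gcongr; linarith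
    rw [hX, hDd]; linarith
  have fin : D * ‖q‖ ^ 2 ≤ X / 2 + D * (2 * D) * Y := by
    have := mul_le_mul_of_nonneg_left hq hD.le
    have e : D * ((2 * D)⁻¹ * X + (2 * D) * Y) = X / 2 + D * (2 * D) * Y := by field_simp
    linarith
  linarith

/-- One-mode operator `iλ - 𝒜ₙ`. -/
def modeMap (y p a b m σ τ l : ℝ) : (ℂ × ℂ × ℂ × ℂ) →ₗ[ℂ] (ℂ × ℂ × ℂ × ℂ) where
  toFun x := (I * (l : ℂ) * x.1 - x.2.1,
    I * (l : ℂ) * x.2.1 - (-(((1 + m * p : ℝ) : ℂ))⁻¹ *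
        (((σ * y : ℝ) : ℂ) * x.1 - (a : ℂ) * x.2.2.1)),
    I * (l : ℂ) * x.2.2.1 - (-(a : ℂ) * x.2.1 + (b : ℂ) * x.2.2.2),
    I * (l : ℂ) * x.2.2.2 - (((τ : ℝ) : ℂ)⁻¹ * (-x.2.2.2 - (b : ℂ) * x.2.2.1)))
  map_add' x z := by
    ext <;> simp <;> ring
  map_smul' k x := by
    ext <;> simp <;> ring

lemma modeMap_surj (y p a b m σ τ l : ℝ) (hy : 0 < y) (hp : 0 < p) (hm : 0 < m) (hσ : 0 < σ)
    (hτ : 0 < τ) (C : ℝ)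
    (h : ∀ u v t q g1 g2 g3 g4 : ℂ,
      I * (l : ℂ) * u - v = g1 →
      I * (l : ℂ) * v - (-(((1 + m * p : ℝ) : ℂ))⁻¹ *
        (((σ * y : ℝ) : ℂ) * u - (a : ℂ) * t)) = g2 →
      I * (l : ℂ) * t - (-(a : ℂ) * v + (b : ℂ) * q) = g3 →
      I * (l : ℂ) * q - (((τ : ℝ) : ℂ)⁻¹ * (-q - (b : ℂ) * t)) = g4 →
      σ * y * ‖u‖ ^ 2 + m * p * ‖v‖ ^ 2 + ‖v‖ ^ 2 + ‖t‖ ^ 2 + τ * ‖q‖ ^ 2 ≤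
        C * (σ * y * ‖g1‖ ^ 2 + m * p * ‖g2‖ ^ 2 + ‖g2‖ ^ 2 + ‖g3‖ ^ 2 + τ * ‖g4‖ ^ 2)) :
    Function.Bijective (modeMap y p a b m σ τ l) := by
  have hi : Function.Injective (modeMap y p a b m σ τ l) := by
    rw [injective_iff_map_eq_zero]
    rintro ⟨u, v, t, q⟩ hx
    simp only [modeMap, LinearMap.coe_mk, AddHom.coe_mk, Prod.mk_eq_zero] at hx
    obtain ⟨e1, e2, e3, e4⟩ := hx
    have := h u v t q 0 0 0 0 e1 e2 e3 e4
    simp only [norm_zero, ne_eq, OfNat.ofNat_ne_zero, not_false_eq_true, zero_pow, mul_zero,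
      add_zero] at this
    have n1 : 0 ≤ σ * y * ‖u‖ ^ 2 := by positivity
    have n2 : 0 ≤ m * p * ‖v‖ ^ 2 := by positivity
    have n2' : 0 ≤ ‖v‖ ^ 2 := by positivity
    have n3 : 0 ≤ ‖t‖ ^ 2 := by positivity
    have n4 : 0 ≤ τ * ‖q‖ ^ 2 := by positivity
    have z1 : σ * y * ‖u‖ ^ 2 = 0 := by linarith
    have z2 : ‖v‖ ^ 2 = 0 := by linarith
    have z3 : ‖t‖ ^ 2 = 0 := by linarith
    have z4 : τ * ‖q‖ ^ 2 = 0 := by linarith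
    simp [hσ.ne', hy.ne', hτ.ne'] at z1 z2 z3 z4
    simp [z1, z2, z3, z4]
  exact ⟨hi, LinearMap.injective_iff_surjective.mp hi⟩

lemma rpow_bound (c : ℝ) (hc : 0 < c) (s : ℝ) (hs : s ≤ 0) (x : ℝ) (hx : c ≤ x) :
    x ^ s ≤ c ^ s := Real.rpow_le_rpow_of_nonpos hc hx hs

/-- With `m > 0`, every nonzero purely imaginary `iλ` belongs to the
resolvent set of the thermoelastic operator `𝒜`: `(iλ − 𝒜)` is a bijection from
`D(𝒜)` onto `ℋ` with bounded inverse. Together with `0 ∈ σ(𝒜)` this gives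
`σ(𝒜) ∩ iℝ = {0}`. -/
theorem thermoOp_imaginary_resolvent (μ : ℕ → ℝ) (m σ τ α β γ : ℝ) (c : ℝ)
    (hc : 0 < c) (hμ : ∀ n, c ≤ μ n) (hμtop : Tendsto μ atTop atTop)
    (hm : 0 < m) (hσ : 0 < σ) (hτ : 0 < τ)
    (hα : α ∈ Set.Icc (0:ℝ) 1) (hβ : β ∈ Set.Icc (0:ℝ) 1) (hγ : γ ∈ Set.Ioc (0:ℝ) 1)
    (hQ : (β + 1) / 2 < α) :
    ∀ lam : ℝ, lam ≠ 0 →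
      ∃ C > (0:ℝ), ∀ G : ThermoSt, thermoMemH μ m σ τ γ G →
        ∃ U : ThermoSt, thermoDom μ m σ τ α β γ U ∧
          (Complex.I * (lam : ℂ)) • U - thermoOp μ m σ τ α β γ U = G ∧
          thermoNormSq μ m σ τ γ U ≤ C * thermoNormSq μ m σ τ γ G ∧
          ∀ U' : ThermoSt, thermoDom μ m σ τ α β γ U' →
            (Complex.I * (lam : ℂ)) • U' - thermoOp μ m σ τ α β γ U' = G → U' = U := by
  intro l hl
  obtain ⟨hα0, hα1⟩ := hα
  obtain ⟨hβ0, hβ1⟩ := hβ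
  obtain ⟨hγ0, hγ1⟩ := hγ
  have hpos : ∀ n, 0 < μ n := fun n => hc.trans_le (hμ n)
  have P : ∀ s : ℝ, 0 < c ^ s := fun s => Real.rpow_pos_of_pos hc s
  obtain ⟨K, hKd⟩ : ∃ K, K = c ^ (γ - 1) + c ^ (-1 : ℝ) + c ^ (-β) + c ^ (1 - 2 * α)
    + c ^ (1 + β - 2 * α) := ⟨_, rfl⟩
  have q1 := P (γ - 1)
  have q2 := P (-1)
  have q3 := P (-β)
  have q4 := P (1 - 2 * α)
  have q5 := P (1 + β - 2 * α)
  have hK : 0 < K := by rw [hKd]; linarith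
  have key : ∀ s : ℝ, s ≤ 0 → c ^ s ≤ K → ∀ n (r w : ℝ), r = s + w →
      (μ n) ^ r ≤ K * (μ n) ^ w := by
    intro s hs hsK n r w hr
    rw [hr, Real.rpow_add (hpos n)]
    exact mul_le_mul_of_nonneg_right ((rpow_bound c hc s hs _ (hμ n)).trans hsK)
      (Real.rpow_pos_of_pos (hpos n) _).le
  have sqr : ∀ n (s : ℝ), (μ n ^ s) ^ 2 = μ n ^ (2 * s) := by
    intro n s
    rw [← Real.rpow_natCast, ← Real.rpow_mul (hpos n).le]; norm_num [mul_comm]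
  have k1 : ∀ n, μ n ^ γ ≤ K * μ n := by
    intro n
    have := key (γ - 1) (by linarith) (by rw [hKd]; linarith) n γ 1 (by ring)
    rwa [Real.rpow_one] at this
  have k2 : ∀ n, 1 ≤ K * μ n := by
    intro n
    have := key (-1) (by linarith) (by rw [hKd]; linarith) n 0 1 (by ring)
    rwa [Real.rpow_one, Real.rpow_zero] at this
  have k3 : ∀ n, 1 ≤ K * (μ n ^ (β / 2)) ^ 2 := by
    intro n
    have := key (-β) (by linarith) (by rw [hKd]; linarith) n 0 (2 * (β / 2)) (by ring)
    rwa [Real.rpow_zero, ← sqr] at this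
  have k4 : ∀ n, μ n ≤ K * (μ n ^ α) ^ 2 := by
    intro n
    have := key (1 - 2 * α) (by linarith) (by rw [hKd]; linarith) n 1 (2 * α) (by ring)
    rwa [Real.rpow_one, ← sqr] at this
  have k5 : ∀ n, μ n * (μ n ^ (β / 2)) ^ 2 ≤ K * (μ n ^ α) ^ 2 := by
    intro n
    have := key (1 + β - 2 * α) (by linarith) (by rw [hKd]; linarith) n (1 + 2 * (β / 2)) (2 * α)
      (by ring)
    rwa [Real.rpow_add (hpos n), Real.rpow_one, ← sqr, ← sqr] at this
  obtain ⟨C, hC, hB⟩ := mode_bound m σ τ l K hm hσ hτ hl hK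
  have hB' := fun n => hB (μ n) (μ n ^ γ) (μ n ^ α) (μ n ^ (β / 2)) (hpos n)
    (Real.rpow_pos_of_pos (hpos n) _) (Real.rpow_pos_of_pos (hpos n) _)
    (Real.rpow_pos_of_pos (hpos n) _) (k1 n) (k2 n) (k3 n) (k4 n) (k5 n)
  have hbij := fun n => modeMap_surj (μ n) (μ n ^ γ) (μ n ^ α) (μ n ^ (β / 2)) m σ τ l (hpos n)
    (Real.rpow_pos_of_pos (hpos n) _) hm hσ hτ C (hB' n)
  have iffmode : ∀ U G : ThermoSt,
      (Complex.I * (l : ℂ)) • U - thermoOp μ m σ τ α β γ U = G ↔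
      ∀ n, modeMap (μ n) (μ n ^ γ) (μ n ^ α) (μ n ^ (β / 2)) m σ τ l
        (U.1 n, U.2.1 n, U.2.2.1 n, U.2.2.2 n) = (G.1 n, G.2.1 n, G.2.2.1 n, G.2.2.2 n) := by
    rintro ⟨u, v, t, q⟩ ⟨g1, g2, g3, g4⟩
    simp only [modeMap, thermoOp, LinearMap.coe_mk, AddHom.coe_mk, Prod.mk.injEq, Prod.smul_mk,
      Prod.mk_sub_mk, funext_iff, Pi.sub_apply, Pi.smul_apply, smul_eq_mul, forall_and]
  have snn : ∀ (U : ThermoSt) n, 0 ≤ thermoSummand μ m σ τ γ U n := by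
    intro U n
    have := hpos n
    have := Real.rpow_pos_of_pos (hpos n) γ
    unfold thermoSummand
    positivity
  refine ⟨C, hC, ?_⟩
  intro G hG
  choose x hx using fun n => (hbij n).2 (G.1 n, G.2.1 n, G.2.2.1 n, G.2.2.2 n)
  obtain ⟨U, hUd⟩ : ∃ U : ThermoSt, U = (fun n => (x n).1, fun n => (x n).2.1,
    fun n => (x n).2.2.1, fun n => (x n).2.2.2) := ⟨_, rfl⟩
  have hUx : ∀ n, modeMap (μ n) (μ n ^ γ) (μ n ^ α) (μ n ^ (β / 2)) m σ τ l
        (U.1 n, U.2.1 n, U.2.2.1 n, U.2.2.2 n) = (G.1 n, G.2.1 n, G.2.2.1 n, G.2.2.2 n) := by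
    intro n; rw [hUd]; exact hx n
  have hUG := (iffmode U G).2 hUx
  have hle : ∀ n, thermoSummand μ m σ τ γ U n ≤ C * thermoSummand μ m σ τ γ G n := by
    intro n
    have h := hUx n
    simp only [modeMap, LinearMap.coe_mk, AddHom.coe_mk, Prod.mk.injEq] at h
    obtain ⟨e1, e2, e3, e4⟩ := h
    exact hB' n _ _ _ _ _ _ _ _ e1 e2 e3 e4
  have hUs : thermoMemH μ m σ τ γ U :=
    Summable.of_nonneg_of_le (snn U) hle (hG.mul_left C)
  have hW : thermoOp μ m σ τ α β γ U = (Complex.I * (l : ℂ)) • U + (-1 : ℂ) • G := by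
    rw [← hUG]; simp
  have hWs : thermoMemH μ m σ τ γ (thermoOp μ m σ τ α β γ U) := by
    rw [hW]
    refine Summable.of_nonneg_of_le (snn _) (fun n => ?_)
      ((hUs.mul_left (2 * l ^ 2)).add (hG.mul_left 2))
    have ns : ∀ z w : ℂ, ‖I * (l : ℂ) * z + -w‖ ^ 2 ≤ 2 * l ^ 2 * ‖z‖ ^ 2 + 2 * ‖w‖ ^ 2 := by
      intro z w
      have := norm_sq_add2 (I * (l : ℂ) * z) (-w)
      simp only [norm_neg, norm_mul, mul_pow, norm_real, norm_I, Real.norm_eq_abs, sq_abs, one_pow,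
        one_mul] at this
      linarith
    have hp := Real.rpow_pos_of_pos (hpos n) γ
    have hy := hpos n
    have s1 := mul_le_mul_of_nonneg_left (ns (U.1 n) (G.1 n)) (by positivity : 0 ≤ σ * μ n)
    have s2 := mul_le_mul_of_nonneg_left (ns (U.2.1 n) (G.2.1 n))
      (by positivity : 0 ≤ m * μ n ^ γ)
    have s3 := ns (U.2.1 n) (G.2.1 n)
    have s4 := ns (U.2.2.1 n) (G.2.2.1 n)
    have s5 := mul_le_mul_of_nonneg_left (ns (U.2.2.2 n) (G.2.2.2 n)) hτ.le
    simp only [thermoSummand, Prod.fst_add, Prod.snd_add, Prod.smul_fst, Prod.smul_snd,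
      Pi.add_apply, Pi.smul_apply, smul_eq_mul, neg_mul, one_mul]
    linarith
  have part : ∀ (W : ThermoSt) n, thermoSummand μ m σ τ γ W n = σ * μ n * ‖W.1 n‖ ^ 2
      + m * μ n ^ γ * ‖W.2.1 n‖ ^ 2 + ‖W.2.1 n‖ ^ 2 + ‖W.2.2.1 n‖ ^ 2
      + τ * ‖W.2.2.2 n‖ ^ 2 := fun _ _ => rfl
  have nn1 : ∀ (W : ThermoSt) n, 0 ≤ σ * μ n * ‖W.1 n‖ ^ 2 := fun W n => by
    have := hpos n; positivity
  have nn2 : ∀ (W : ThermoSt) n, 0 ≤ m * μ n ^ γ * ‖W.2.1 n‖ ^ 2 := fun W n => by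
    have := Real.rpow_pos_of_pos (hpos n) γ; positivity
  have nn3 : ∀ (W : ThermoSt) n, 0 ≤ ‖W.2.1 n‖ ^ 2 := fun W n => by positivity
  have nn4 : ∀ (W : ThermoSt) n, 0 ≤ ‖W.2.2.1 n‖ ^ 2 := fun W n => by positivity
  have nn5 : ∀ (W : ThermoSt) n, 0 ≤ τ * ‖W.2.2.2 n‖ ^ 2 := fun W n => by positivity
  refine ⟨U, ⟨hUs, hWs, ?_, ?_, ?_, ?_⟩, hUG, ?_, ?_⟩
  · refine Summable.of_nonneg_of_le (fun n => mul_nonneg (hpos n).le (by positivity)) (fun n => ?_)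
      ((hUs.mul_left (2 * l ^ 2 / σ)).add (hG.mul_left (2 / σ)))
    have e : U.2.1 n = I * (l : ℂ) * U.1 n + -G.1 n := by
      have h := hUx n
      simp only [modeMap, LinearMap.coe_mk, AddHom.coe_mk, Prod.mk.injEq] at h
      rw [← h.1]; ring
    have f := norm_sq_add2 (I * (l : ℂ) * U.1 n) (-G.1 n)
    rw [← e] at f
    simp only [norm_neg, norm_mul, mul_pow, norm_real, norm_I, Real.norm_eq_abs, sq_abs, one_pow,
        one_mul] at f
    have a1 : σ * μ n * ‖U.1 n‖ ^ 2 ≤ thermoSummand μ m σ τ γ U n := by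
      rw [part]; linarith [nn2 U n, nn3 U n, nn4 U n, nn5 U n]
    have a2 : σ * μ n * ‖G.1 n‖ ^ 2 ≤ thermoSummand μ m σ τ γ G n := by
      rw [part]; linarith [nn2 G n, nn3 G n, nn4 G n, nn5 G n]
    have hy := hpos n
    calc μ n * ‖U.2.1 n‖ ^ 2 ≤ μ n * (2 * (l ^ 2 * ‖U.1 n‖ ^ 2 + ‖G.1 n‖ ^ 2)) := by gcongr
      _ = 2 * l ^ 2 / σ * (σ * μ n * ‖U.1 n‖ ^ 2) + 2 / σ * (σ * μ n * ‖G.1 n‖ ^ 2) := by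
          field_simp
      _ ≤ 2 * l ^ 2 / σ * thermoSummand μ m σ τ γ U n + 2 / σ * thermoSummand μ m σ τ γ G n := by
          gcongr
  · refine Summable.of_nonneg_of_le
      (fun n => mul_nonneg (Real.rpow_pos_of_pos (hpos n) _).le (by positivity)) (fun n => ?_)
      (hWs.mul_left (c ^ (-γ) + m))
    have hp := Real.rpow_pos_of_pos (hpos n) γ
    have hd : 0 < 1 + m * μ n ^ γ := by positivity
    have hdc : (((1 + m * μ n ^ γ : ℝ) : ℂ)) ≠ 0 := by exact_mod_cast hd.ne'
    have e : ((σ * μ n : ℝ) : ℂ) * U.1 n - ((μ n ^ α : ℝ) : ℂ) * U.2.2.1 n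
        = -(((1 + m * μ n ^ γ : ℝ) : ℂ) * (thermoOp μ m σ τ α β γ U).2.1 n) := by
      simp only [thermoOp]
      field_simp
    rw [e, norm_neg, norm_mul, mul_pow, norm_real, Real.norm_eq_abs, sq_abs]
    have hb := rpow_bound c hc (-γ) (by linarith) _ (hμ n)
    have hpp : μ n ^ (-γ) * μ n ^ γ = 1 := by
      rw [← Real.rpow_add (hpos n)]; simp
    set w := ‖(thermoOp μ m σ τ α β γ U).2.1 n‖ ^ 2 with hw
    have hw0 : 0 ≤ w := by positivity
    have a1 : (1 + m * μ n ^ γ) * w ≤ thermoSummand μ m σ τ γ (thermoOp μ m σ τ α β γ U) n := by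
      rw [part]
      linarith [nn1 (thermoOp μ m σ τ α β γ U) n, nn4 (thermoOp μ m σ τ α β γ U) n,
        nn5 (thermoOp μ m σ τ α β γ U) n]
    have : 0 < c ^ (-γ) := P _
    calc μ n ^ (-γ) * ((1 + m * μ n ^ γ) ^ 2 * w)
        = (μ n ^ (-γ) + m * (μ n ^ (-γ) * μ n ^ γ)) * ((1 + m * μ n ^ γ) * w) := by ring
      _ ≤ (c ^ (-γ) + m) * ((1 + m * μ n ^ γ) * w) := by
          rw [hpp, mul_one]; gcongr
      _ ≤ _ := by gcongr
  · refine Summable.of_nonneg_of_le (fun n => by positivity) (fun n => ?_) hWs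
    rw [part]
    have a : ‖-((μ n ^ α : ℝ) : ℂ) * U.2.1 n + ((μ n ^ (β / 2) : ℝ) : ℂ) * U.2.2.2 n‖ ^ 2
      = ‖(thermoOp μ m σ τ α β γ U).2.2.1 n‖ ^ 2 := rfl
    rw [a]
    linarith [nn1 (thermoOp μ m σ τ α β γ U) n, nn2 (thermoOp μ m σ τ α β γ U) n,
      nn3 (thermoOp μ m σ τ α β γ U) n, nn5 (thermoOp μ m σ τ α β γ U) n]
  · refine Summable.of_nonneg_of_le (fun n => by positivity) (fun n => ?_) (hWs.mul_left τ)
    have hτc : (τ : ℂ) ≠ 0 := by exact_mod_cast hτ.ne'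
    have e : U.2.2.2 n + ((μ n ^ (β / 2) : ℝ) : ℂ) * U.2.2.1 n
      = -((τ : ℂ) * (thermoOp μ m σ τ α β γ U).2.2.2 n) := by
      simp only [thermoOp]
      field_simp
      ring
    rw [e, norm_neg, norm_mul, mul_pow, norm_real, Real.norm_eq_abs, sq_abs, sq τ, mul_assoc]
    refine mul_le_mul_of_nonneg_left ?_ hτ.le
    rw [part]
    linarith [nn1 (thermoOp μ m σ τ α β γ U) n, nn2 (thermoOp μ m σ τ α β γ U) n,
      nn3 (thermoOp μ m σ τ α β γ U) n, nn4 (thermoOp μ m σ τ α β γ U) n]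
  · unfold thermoNormSq
    rw [← tsum_mul_left]
    exact Summable.tsum_le_tsum hle hUs (hG.mul_left C)
  · intro U' _ hU'
    have h' := (iffmode U' G).1 hU'
    have : ∀ n, (U'.1 n, U'.2.1 n, U'.2.2.1 n, U'.2.2.2 n) = (U.1 n, U.2.1 n, U.2.2.1 n, U.2.2.2 n) :=
      fun n => (hbij n).1 ((h' n).trans (hUx n).symm)
    simp only [Prod.mk.injEq] at this
    refine Prod.ext (funext fun n => (this n).1) (Prod.ext (funext fun n => (this n).2.1)
      (Prod.ext (funext fun n => (this n).2.2.1) (funext fun n => (this n).2.2.2)))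
end
end

section
/- Let A generate a bounded C₀-semigroup (T(t)) on a Hilbert space with σ(A) ∩ iℝ = {0}, and suppose ‖(is − A)^{-1}‖ = O(|s|^{-l}) as s → 0 and ‖(is − A)^{-1}‖ = O(|s|^{k}) as |s| → ∞, for some l ≥ 1, k > 0. Then ‖T(t)A(I − A)^{-2}‖ = O(t^{-1/a}) as t → ∞, where a = max{l, k}. -/
open Complex Filter

noncomputable section

/-- `R` is the bounded resolvent operator `(zI − A)⁻¹` of the (unbounded, partially
defined) operator `A` at the point `z`; its existence means `z` belongs to the
resolvent set `ρ(A)`. -/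
def IsResolventAt {H : Type*} [NormedAddCommGroup H] [InnerProductSpace ℂ H]
    (A : H →ₗ.[ℂ] H) (z : ℂ) (R : H →L[ℂ] H) : Prop :=
  (∀ y : H, ∃ h : R y ∈ A.domain, z • R y - A ⟨R y, h⟩ = y) ∧
  ∀ x : A.domain, R (z • (x : H) - A x) = (x : H)

section Plancherel

open MeasureTheory FourierTransform SchwartzMap
open scoped ContDiff

theorem bct_plancherel {H : Type*} [NormedAddCommGroup H] [InnerProductSpace ℂ H] [CompleteSpace H]
    (f : ℝ → H) (hf : Integrable f) (hf2 : MemLp f 2) :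
    eLpNorm (𝓕 f) 2 volume = eLpNorm f 2 volume := by
  set F := hf2.toLp f with hF
  set u : Lp (α := ℝ) H 2 volume := 𝓕 F with hu
  have hnorm : eLpNorm (u : ℝ → H) 2 volume = eLpNorm f 2 volume := by
    have h1 : ‖u‖ = ‖F‖ := Lp.norm_fourier_eq (E := ℝ) F
    rw [Lp.norm_def, Lp.norm_def] at h1
    have h2 := (ENNReal.toReal_eq_toReal_iff' (Lp.eLpNorm_ne_top u) (Lp.eLpNorm_ne_top F)).1 h1
    rw [h2]
    exact eLpNorm_congr_ae hf2.coeFn_toLp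
  have hcont : Continuous (𝓕 f) := by
    exact VectorFourier.fourierIntegral_continuous Real.continuous_fourierChar
      continuous_inner hf
  rw [← hnorm]
  symm
  apply eLpNorm_congr_ae
  apply ae_eq_of_integral_contDiff_smul_eq
  · exact (Lp.memLp u).locallyIntegrable (by norm_num)
  · exact hcont.locallyIntegrable
  · intro g g_smooth g_cpt
    have hg₁ : HasCompactSupport (Complex.ofRealCLM ∘ g) := g_cpt.comp_left rfl
    have hg₂ : ContDiff ℝ ∞ (Complex.ofRealCLM ∘ g) := by fun_prop
    set G : 𝓢(ℝ, ℂ) := hg₁.toSchwartzMap hg₂ with hG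
    have hGx : ∀ x, G x = (g x : ℂ) := fun x => by simp [hG]
    have e1 : (u : 𝓢'(ℝ, H)) G = (F : 𝓢'(ℝ, H)) (𝓕 G) := by
      rw [hu, ← Lp.fourier_toTemperedDistribution_eq]
      rfl
    rw [Lp.toTemperedDistribution_apply, Lp.toTemperedDistribution_apply] at e1
    have e2 : ∫ x, (𝓕 G) x • F x = ∫ x, (𝓕 G) x • f x := by
      apply integral_congr_ae
      filter_upwards [hf2.coeFn_toLp] with x hx
      rw [hx]
    have e3 : ∫ x, (𝓕 G) x • f x = ∫ x, G x • 𝓕 f x := by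
      have := VectorFourier.integral_fourierIntegral_smul_eq_flip (L := innerₗ ℝ)
        (μ := volume) (ν := volume) Real.continuous_fourierChar continuous_inner
        G.integrable hf
      rw [flip_innerₗ] at this
      exact this
    rw [e2, e3] at e1
    simpa [hGx] using e1

end Plancherel

section Semigroup

set_option linter.unusedSectionVars false

open MeasureTheory Topology

/-- Bounded strongly continuous semigroup. -/
structure BctSemi {H : Type*} [NormedAddCommGroup H] [InnerProductSpace ℂ H]
    (T : ℝ → (H →L[ℂ] H)) (M : ℝ) : Prop where
  zero : T 0 = ContinuousLinearMap.id ℂ H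
  add : ∀ s ≥ (0:ℝ), ∀ t ≥ (0:ℝ), T (s + t) = (T s).comp (T t)
  one_le : 1 ≤ M
  bdd : ∀ t ≥ (0:ℝ), ‖T t‖ ≤ M
  cont : ∀ x : H, ContinuousWithinAt (fun t => T t x) (Set.Ici 0) 0

variable {H : Type*} [NormedAddCommGroup H] [InnerProductSpace ℂ H] [CompleteSpace H]
  {T : ℝ → (H →L[ℂ] H)} {M : ℝ}

theorem BctSemi.bdd_apply (h : BctSemi T M) {t : ℝ} (ht : 0 ≤ t) (x : H) :
    ‖T t x‖ ≤ M * ‖x‖ :=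
  (T t).le_of_opNorm_le (h.bdd t ht) x

theorem BctSemi.diff_le (h : BctSemi T M) (x : H) {s t : ℝ} (hs : 0 ≤ s) (hst : s ≤ t) :
    ‖T t x - T s x‖ ≤ M * ‖T (t - s) x - x‖ := by
  have h1 : T t x = T s (T (t - s) x) := by
    have := h.add s hs (t - s) (by linarith)
    rw [show s + (t - s) = t by ring] at this
    rw [this]; rfl
  rw [h1, ← map_sub]
  exact h.bdd_apply hs _

theorem BctSemi.diff_le' (h : BctSemi T M) (x : H) {s t : ℝ} (hs : 0 ≤ s) (ht : 0 ≤ t) :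
    ‖T t x - T s x‖ ≤ M * ‖T |t - s| x - x‖ := by
  rcases le_total s t with hst | hst
  · rw [abs_of_nonneg (by linarith)]
    exact h.diff_le x hs hst
  · rw [abs_of_nonpos (by linarith), norm_sub_rev, neg_sub]
    exact h.diff_le x ht hst

theorem BctSemi.continuous (h : BctSemi T M) (x : H) :
    Continuous (fun t : ℝ => T (max t 0) x) := by
  rw [continuous_iff_continuousAt]
  intro s
  rw [ContinuousAt, tendsto_iff_norm_sub_tendsto_zero]
  have h0 : Tendsto (fun t : ℝ => M * ‖T |max t 0 - max s 0| x - x‖) (𝓝 s) (𝓝 0) := by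
    have h1 : Tendsto (fun t : ℝ => |max t 0 - max s 0|) (𝓝 s) (𝓝[Set.Ici 0] 0) := by
      apply tendsto_nhdsWithin_iff.2
      refine ⟨?_, Eventually.of_forall fun t => Set.mem_Ici.2 (abs_nonneg _)⟩
      have : Continuous (fun t : ℝ => |max t 0 - max s 0|) := by fun_prop
      have h2 := this.tendsto s
      simpa using h2
    have h2 := (h.cont x).tendsto.comp h1
    have h3 : Tendsto (fun t : ℝ => T |max t 0 - max s 0| x) (𝓝 s) (𝓝 x) := by
      simpa [h.zero, Function.comp_def] using h2
    have h4 := ((h3.sub_const x).norm).const_mul M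
    simpa using h4
  refine squeeze_zero (fun _ => norm_nonneg _) (fun t => ?_) h0
  exact h.diff_le' x (le_max_right _ _) (le_max_right _ _)

theorem BctSemi.cont_exp (h : BctSemi T M) (z : ℂ) (x : H) :
    Continuous (fun t : ℝ => Complex.exp (-z * t) • T (max t 0) x) := by
  have := h.continuous x
  have h2 : Continuous (fun t : ℝ => Complex.exp (-z * t)) := by fun_prop
  exact h2.smul this

theorem BctSemi.norm_exp_le (h : BctSemi T M) (z : ℂ) (x : H) (t : ℝ) :
    ‖Complex.exp (-z * t) • T (max t 0) x‖ ≤ (M * ‖x‖) * Real.exp (-z.re * t) := by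
  rw [norm_smul, Complex.norm_exp, mul_comm]
  simp only [Complex.mul_re, Complex.neg_re, Complex.ofReal_re, Complex.ofReal_im, mul_zero,
    sub_zero]
  gcongr
  exact h.bdd_apply (le_max_right _ _) x

theorem BctSemi.integrableOn (h : BctSemi T M) {z : ℂ} (hz : 0 < z.re) (x : H) :
    IntegrableOn (fun t : ℝ => Complex.exp (-z * t) • T (max t 0) x) (Set.Ioi 0) := by
  refine Integrable.mono' ((integrableOn_exp_mul_Ioi (a := -z.re) (by linarith) 0).const_mul
    (M * ‖x‖)) (h.cont_exp z x).aestronglyMeasurable ?_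
  exact Eventually.of_forall fun t => h.norm_exp_le z x t

theorem BctSemi.exists_laplace (h : BctSemi T M) : ∃ L : ℂ → (H →L[ℂ] H), ∀ z : ℂ, 0 < z.re →
    (‖L z‖ ≤ M / z.re ∧
      ∀ x, L z x = ∫ t in Set.Ioi (0:ℝ), Complex.exp (-z * t) • T (max t 0) x) := by
  have key : ∀ z : ℂ, ∃ Lz : H →L[ℂ] H, 0 < z.re → (‖Lz‖ ≤ M / z.re ∧
      ∀ x, Lz x = ∫ t in Set.Ioi (0:ℝ), Complex.exp (-z * t) • T (max t 0) x) := by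
    intro z
    by_cases hz : 0 < z.re
    · have hM := h.one_le
      let f : H →ₗ[ℂ] H :=
        { toFun := fun x => ∫ t in Set.Ioi (0:ℝ), Complex.exp (-z * t) • T (max t 0) x
          map_add' := by
            intro x y
            rw [← integral_add (h.integrableOn hz x) (h.integrableOn hz y)]
            simp [smul_add]
          map_smul' := by
            intro c x
            rw [← integral_smul]
            simp only [map_smul, RingHom.id_apply]
            congr 1
            ext t
            rw [smul_comm] }
      have hb : ∀ x, ‖f x‖ ≤ M / z.re * ‖x‖ := by
        intro x
        have h1 : ‖f x‖ ≤ ∫ t in Set.Ioi (0:ℝ), (M * ‖x‖) * Real.exp (-z.re * t) :=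
          norm_integral_le_of_norm_le
            ((integrableOn_exp_mul_Ioi (a := -z.re) (by linarith) 0).const_mul (M * ‖x‖))
            (Eventually.of_forall fun t => h.norm_exp_le z x t)
        refine h1.trans (le_of_eq ?_)
        rw [integral_const_mul, integral_exp_mul_Ioi (by linarith)]
        simp
        field_simp
      exact ⟨f.mkContinuous (M / z.re) hb, fun _ =>
        ⟨LinearMap.mkContinuous_norm_le _ (by positivity) _, fun x => rfl⟩⟩
    · exact ⟨0, fun h' => absurd h' hz⟩
  choose L hL using key
  exact ⟨L, hL⟩

/-- `L` is the Laplace transform of `T`. -/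
def BctLap (T : ℝ → (H →L[ℂ] H)) (L : ℂ → (H →L[ℂ] H)) : Prop :=
  ∀ z : ℂ, 0 < z.re → ∀ x, L z x = ∫ t in Set.Ioi (0:ℝ), Complex.exp (-z * t) • T (max t 0) x

theorem BctLap.comm_T {L : ℂ → (H →L[ℂ] H)} (h : BctSemi T M) (hL : BctLap T L) {z : ℂ}
    (hz : 0 < z.re) {s : ℝ} (hs : 0 ≤ s) (x : H) : L z (T s x) = T s (L z x) := by
  rw [hL z hz, hL z hz, ← ContinuousLinearMap.integral_comp_comm _ (h.integrableOn hz x)]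
  congr 1
  ext t
  rw [map_smul]
  have h1 := h.add s hs (max t 0) (le_max_right _ _)
  have h2 := h.add (max t 0) (le_max_right _ _) s hs
  rw [add_comm] at h2
  rw [h1] at h2
  have := congrArg (fun f : H →L[ℂ] H => f x) h2
  simp only [ContinuousLinearMap.comp_apply] at this
  rw [this]

theorem BctLap.comm {L : ℂ → (H →L[ℂ] H)} (h : BctSemi T M) (hL : BctLap T L) {z w : ℂ}
    (hz : 0 < z.re) (hw : 0 < w.re) (x : H) : L z (L w x) = L w (L z x) := by
  rw [hL w hw x, ← ContinuousLinearMap.integral_comp_comm _ (h.integrableOn hw x), hL w hw]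
  congr 1
  ext t
  rw [map_smul, hL.comm_T h hz (le_max_right _ _)]

theorem BctLap.T_apply {L : ℂ → (H →L[ℂ] H)} (h : BctSemi T M) (hL : BctLap T L) {z : ℂ}
    (hz : 0 < z.re) {s : ℝ} (hs : 0 ≤ s) (x : H) : T s (L z x) =
      Complex.exp (z * s) • (L z x - ∫ t in (0:ℝ)..s, Complex.exp (-z * t) • T (max t 0) x) := by
  set g := fun t : ℝ => Complex.exp (-z * t) • T (max t 0) x with hg
  have e1 : T s (L z x) = ∫ t in Set.Ioi (0:ℝ), Complex.exp (z * s) • g (t + s) := by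
    rw [hL z hz, ← ContinuousLinearMap.integral_comp_comm _ (h.integrableOn hz x)]
    apply setIntegral_congr_fun measurableSet_Ioi
    intro t ht
    have ht' : (0:ℝ) ≤ t := le_of_lt ht
    simp only [hg, map_smul]
    rw [max_eq_left ht', max_eq_left (by linarith), smul_smul, ← Complex.exp_add, add_comm t s,
      h.add s hs t ht']
    simp only [ContinuousLinearMap.comp_apply]
    congr 2
    push_cast
    ring
  rw [e1, integral_smul]
  congr 1
  have e2 : ∫ t in Set.Ioi (0:ℝ), g (t + s) = ∫ t in Set.Ioi s, g t := by
    have := (measurePreserving_add_right (volume : Measure ℝ) s).setIntegral_preimage_emb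
      (measurableEmbedding_addRight s) g (Set.Ioi s)
    rw [← this]
    simp
  rw [e2, hL z hz]
  have := intervalIntegral.integral_interval_add_Ioi' (f := g) (μ := volume) (a := 0) (b := s)
    ((h.cont_exp z x).intervalIntegrable _ _)
    ((h.integrableOn hz x).mono_set (Set.Ioi_subset_Ioi hs))
  rw [← this]
  simp

theorem BctLap.gen {L : ℂ → (H →L[ℂ] H)} (h : BctSemi T M) (hL : BctLap T L) {z : ℂ}
    (hz : 0 < z.re) (x : H) :
    Tendsto (fun t : ℝ => t⁻¹ • (T t (L z x) - L z x)) (𝓝[>] 0) (𝓝 (z • L z x - x)) := by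
  set g := fun t : ℝ => Complex.exp (-z * t) • T (max t 0) x with hg
  have hd1 : HasDerivAt (fun s : ℝ => L z x - ∫ t in (0:ℝ)..s, g t) (-(g 0)) 0 := by
    have := intervalIntegral.integral_hasDerivAt_right (f := g) (a := 0) (b := 0)
      ((h.cont_exp z x).intervalIntegrable _ _)
      ((h.cont_exp z x).stronglyMeasurableAtFilter _ _) (h.cont_exp z x).continuousAt
    simpa using this.const_sub (L z x)
  have hd2 : HasDerivAt (fun s : ℝ => Complex.exp (z * s)) z 0 := by
    have h1 : HasDerivAt (fun s : ℝ => z * (s : ℂ)) (z * 1) 0 :=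
      (Complex.ofRealCLM.hasDerivAt (x := (0:ℝ))).const_mul z
    simpa using h1.cexp
  have hd := (hd2.smul hd1).tendsto_slope_zero_right
  have hg0 : g 0 = x := by simp [hg, h.zero]
  simp only [zero_add] at hd
  have e : (Complex.exp (z * ((0:ℝ):ℂ)) • -(g 0) + z • (L z x - ∫ t in (0:ℝ)..0, g t)) =
      z • L z x - x := by
    rw [hg0]; simp; abel
  simp only [Pi.smul_apply', e] at hd
  refine hd.congr' ?_
  filter_upwards [self_mem_nhdsWithin] with t ht
  rw [hL.T_apply h hz (le_of_lt ht)]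
  simp [hg]

theorem BctLap.isResolvent {L : ℂ → (H →L[ℂ] H)} (h : BctSemi T M) (hL : BctLap T L)
    (A : H →ₗ.[ℂ] H)
    (hgen : ∀ (x : H), (∃ hx : x ∈ A.domain, Tendsto (fun t : ℝ => t⁻¹ • (T t x - x))
        (nhdsWithin 0 (Set.Ioi 0)) (nhds (A ⟨x, hx⟩))) ↔
      ∃ y : H, Tendsto (fun t : ℝ => t⁻¹ • (T t x - x)) (nhdsWithin 0 (Set.Ioi 0)) (nhds y))
    (R1 : H →L[ℂ] H) (hR1 : IsResolventAt A 1 R1) :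
    R1 = L 1 ∧ ∀ z : ℂ, 0 < z.re → IsResolventAt A z (L z) := by
  have hi : ∀ z : ℂ, 0 < z.re → ∀ y : H, ∃ h : L z y ∈ A.domain, z • L z y - A ⟨L z y, h⟩ = y := by
    intro z hz y
    have h1 := hL.gen h hz y
    obtain ⟨hx, h2⟩ := (hgen (L z y)).2 ⟨_, h1⟩
    refine ⟨hx, ?_⟩
    rw [tendsto_nhds_unique h2 h1]
    abel
  have hR : ∀ z : ℂ, 0 < z.re → ∀ y, R1 ((1 - z) • L z y + y) = L z y := by
    intro z hz y
    obtain ⟨h1, h2⟩ := hi z hz y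
    have h3 := hR1.2 ⟨L z y, h1⟩
    simp only at h3
    convert h3 using 2
    nth_rewrite 2 [← h2]
    module
  have h1 : R1 = L 1 := by
    ext y
    have := hR 1 (by simp) y
    simpa using this
  refine ⟨h1, fun z hz => ⟨hi z hz, ?_⟩⟩
  intro x
  set y := (1:ℂ) • (x:H) - A x with hy
  have hx : (x:H) = L 1 y := by rw [← h1, hR1.2 x]
  have hx2 : z • (x:H) - A x = (z - 1) • L 1 y + y := by
    rw [← hx, hy]; module
  rw [hx2, map_add, map_smul, hL.comm h hz (by simp), hx]
  have := hR z hz y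
  rw [h1, map_add, map_smul] at this
  nth_rewrite 2 [← this]
  module

end Semigroup

section Decay

open MeasureTheory Topology FourierTransform

set_option linter.unusedSectionVars false

variable {H : Type*} [NormedAddCommGroup H] [InnerProductSpace ℂ H] [CompleteSpace H]
  {T : ℝ → (H →L[ℂ] H)} {M : ℝ}

theorem IsResolventAt.identity {A : H →ₗ.[ℂ] H} {z w : ℂ} {R S : H →L[ℂ] H}
    (hz : IsResolventAt A z R) (hw : IsResolventAt A w S) (x : H) :
    R x - S x = (w - z) • R (S x) := by
  obtain ⟨h1, h2⟩ := hw.1 x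
  have h3 := hz.2 ⟨S x, h1⟩
  simp only at h3
  have h4 : z • S x - A ⟨S x, h1⟩ = x + (z - w) • S x := by
    nth_rewrite 3 [← h2]
    module
  rw [h4, map_add, map_smul] at h3
  have h5 : R x = S x - (z - w) • R (S x) := eq_sub_of_add_eq h3
  rw [h5]
  module

theorem bct_exp_bound {f : ℝ → H} (hf : AEStronglyMeasurable f volume) {C c : ℝ} (hc : 0 < c)
    (hb : ∀ t, ‖f t‖ ≤ (Set.Ioi (0:ℝ)).indicator (fun t => C * Real.exp (-c * t)) t) :
    Integrable f ∧ MemLp f 2 volume ∧ ∫ t, ‖f t‖ ^ 2 ≤ C ^ 2 / (2 * c) := by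
  have hi1 : Integrable ((Set.Ioi (0:ℝ)).indicator (fun t => C * Real.exp (-c * t))) :=
    (integrable_indicator_iff measurableSet_Ioi).2
      ((integrableOn_exp_mul_Ioi (by linarith) 0).const_mul C)
  have hi2 : Integrable ((Set.Ioi (0:ℝ)).indicator (fun t => C ^ 2 * Real.exp (-(2 * c) * t))) :=
    (integrable_indicator_iff measurableSet_Ioi).2
      ((integrableOn_exp_mul_Ioi (by linarith) 0).const_mul (C ^ 2))
  have hb2 : ∀ t, ‖f t‖ ^ 2 ≤
      (Set.Ioi (0:ℝ)).indicator (fun t => C ^ 2 * Real.exp (-(2 * c) * t)) t := by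
    intro t
    have h1 := pow_le_pow_left₀ (norm_nonneg _) (hb t) 2
    refine h1.trans (le_of_eq ?_)
    by_cases ht : t ∈ Set.Ioi (0:ℝ)
    · simp only [Set.indicator_of_mem ht]
      rw [mul_pow, ← Real.exp_nat_mul]
      congr 2
      push_cast; ring
    · simp only [Set.indicator_of_notMem ht]
      norm_num
  have hint2 : Integrable (fun t => ‖f t‖ ^ 2) := by
    refine hi2.mono' (hf.norm.pow 2) (Eventually.of_forall fun t => ?_)
    rw [Real.norm_of_nonneg (by positivity)]
    exact hb2 t
  refine ⟨hi1.mono' hf (Eventually.of_forall hb), (memLp_two_iff_integrable_sq_norm hf).2 hint2, ?_⟩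
  refine (integral_mono hint2 hi2 hb2).trans (le_of_eq ?_)
  rw [integral_indicator measurableSet_Ioi, integral_const_mul,
    integral_exp_mul_Ioi (by linarith)]
  simp
  field_simp

/-- the function whose Fourier transform is the resolvent -/
def bctG (T : ℝ → (H →L[ℂ] H)) (ε : ℝ) (x : H) : ℝ → H :=
  (Set.Ioi (0:ℝ)).indicator (fun t : ℝ => Complex.exp (-(ε:ℂ) * t) • T (max t 0) x)

theorem bctG_meas (h : BctSemi T M) (ε : ℝ) (x : H) :
    AEStronglyMeasurable (bctG T ε x) volume :=
  (h.cont_exp ε x).aestronglyMeasurable.indicator measurableSet_Ioi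

theorem bctG_bound (h : BctSemi T M) (ε : ℝ) (x : H) (t : ℝ) :
    ‖bctG T ε x t‖ ≤ (Set.Ioi (0:ℝ)).indicator (fun t => (M * ‖x‖) * Real.exp (-ε * t)) t := by
  by_cases ht : t ∈ Set.Ioi (0:ℝ)
  · simp only [bctG, Set.indicator_of_mem ht]
    simpa using h.norm_exp_le ε x t
  · simp [bctG, Set.indicator_of_notMem ht]

theorem bctG_bound' (h : BctSemi T M) {ε : ℝ} (hε : 0 < ε) (x : H) (t : ℝ) :
    ‖t • bctG T ε x t‖ ≤ (Set.Ioi (0:ℝ)).indicator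
      (fun t => (2 / ε * (M * ‖x‖)) * Real.exp (-(ε / 2) * t)) t := by
  have h0 := bctG_bound h ε x t
  have hM := h.one_le
  by_cases ht : t ∈ Set.Ioi (0:ℝ)
  · simp only [Set.indicator_of_mem ht] at h0 ⊢
    have ht' : 0 < t := ht
    rw [norm_smul, Real.norm_of_nonneg ht'.le]
    have h1 : t ≤ 2 / ε * Real.exp (ε / 2 * t) := by
      have := Real.add_one_le_exp (ε / 2 * t)
      have h2 : t = 2 / ε * (ε / 2 * t) := by field_simp
      nth_rewrite 1 [h2]
      gcongr
      linarith
    calc t * ‖bctG T ε x t‖ ≤ (2 / ε * Real.exp (ε / 2 * t)) * ((M * ‖x‖) * Real.exp (-ε * t)) := by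
          gcongr
      _ = (2 / ε * (M * ‖x‖)) * (Real.exp (ε / 2 * t) * Real.exp (-ε * t)) := by ring
      _ = _ := by
          rw [← Real.exp_add]
          congr 2
          ring
  · simp [bctG, Set.indicator_of_notMem ht]

theorem bctG_fourier {L : ℂ → (H →L[ℂ] H)} (hL : BctLap T L) {ε : ℝ} (hε : 0 < ε)
    (x : H) (w : ℝ) : 𝓕 (bctG T ε x) w = L (ε + 2 * Real.pi * w * I) x := by
  rw [hL _ (by simpa using hε), Real.fourier_real_eq_integral_exp_smul,
    ← integral_indicator measurableSet_Ioi]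
  congr 1
  ext t
  by_cases ht : t ∈ Set.Ioi (0:ℝ)
  · simp only [bctG, Set.indicator_of_mem ht]
    rw [smul_smul, ← Complex.exp_add]
    congr 2
    push_cast
    ring
  · simp [bctG, Set.indicator_of_notMem ht]

theorem bctG_fourier' (h : BctSemi T M) {L : ℂ → (H →L[ℂ] H)} (hL : BctLap T L)
    (hid : ∀ z w : ℂ, 0 < z.re → 0 < w.re → ∀ x, L z x - L w x = (w - z) • L z (L w x))
    {ε : ℝ} (hε : 0 < ε) (x : H) (w : ℝ) :
    𝓕 (fun t : ℝ => t • bctG T ε x t) w =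
      L (ε + 2 * Real.pi * w * I) (L (ε + 2 * Real.pi * w * I) x) := by
  have hfi : ∀ y, Integrable (bctG T ε y) := fun y =>
    (bct_exp_bound (bctG_meas h ε y) hε (bctG_bound h ε y)).1
  have hfi' : ∀ y, Integrable (fun t : ℝ => t • bctG T ε y t) := fun y =>
    (bct_exp_bound (continuous_id.aestronglyMeasurable.smul (bctG_meas h ε y)) (half_pos hε)
      (bctG_bound' h hε y)).1
  have hfun : ∀ y, 𝓕 (bctG T ε y) = fun w : ℝ => L (ε + 2 * Real.pi * w * I) y := fun y => by
    ext w; exact bctG_fourier hL hε y w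
  have hd : ∀ y, HasDerivAt (fun w : ℝ => L (ε + 2 * Real.pi * w * I) y)
      (𝓕 (fun t : ℝ => (-2 * Real.pi * I * t) • bctG T ε y t) w) w := by
    intro y
    rw [← hfun y]
    exact Real.hasDerivAt_fourier (hfi y) (hfi' y) w
  set z : ℂ := ε + 2 * Real.pi * w * I with hz
  have hlin : HasDerivAt (fun v : ℝ => z - (ε + 2 * Real.pi * v * I : ℂ)) (-(2 * Real.pi * I)) w := by
    have h1 : HasDerivAt (fun v : ℝ => ((v:ℝ):ℂ)) 1 w := Complex.ofRealCLM.hasDerivAt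
    have h2 := ((((h1.const_mul (2 * Real.pi : ℂ)).mul_const I).const_add (ε:ℂ)).const_sub z)
    simpa using h2
  have hd2 := (hlin.smul (hd (L z x))).add_const (L z x)
  have heq : (fun w : ℝ => L (ε + 2 * Real.pi * w * I) x) =
      fun v : ℝ => ((fun v : ℝ => z - (ε + 2 * Real.pi * v * I : ℂ)) •
        fun w : ℝ => L (ε + 2 * Real.pi * w * I) (L z x)) v + L z x := by
    ext v
    have := hid (ε + 2 * Real.pi * v * I) z (by simpa using hε) (by simpa [hz] using hε) x
    simp only [Pi.smul_apply']
    rw [← this]; simp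
  have h1 := (hd x).unique (heq ▸ hd2)
  have h2 : 𝓕 (fun t : ℝ => (-2 * Real.pi * I * t) • bctG T ε x t) w =
      (-2 * Real.pi * I : ℂ) • 𝓕 (fun t : ℝ => t • bctG T ε x t) w := by
    rw [Real.fourier_real_eq_integral_exp_smul, Real.fourier_real_eq_integral_exp_smul,
      ← integral_smul]
    congr 1
    ext t
    rw [← Complex.coe_smul t, smul_smul, smul_smul, smul_smul]
    congr 1
    ring
  rw [h2] at h1
  have h3 : (-2 * Real.pi * I : ℂ) ≠ 0 := by simp [Real.pi_ne_zero]
  have h4 : (-2 * Real.pi * I : ℂ) • 𝓕 (fun t : ℝ => t • bctG T ε x t) w =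
      (-2 * Real.pi * I : ℂ) • L z (L z x) := by
    rw [h1]
    simp [← hz]
  exact smul_right_injective H h3 h4

theorem bct_decay (h : BctSemi T M) {L : ℂ → (H →L[ℂ] H)} (hL : BctLap T L)
    (hid : ∀ z w : ℂ, 0 < z.re → 0 < w.re → ∀ x, L z x - L w x = (w - z) • L z (L w x))
    {t : ℝ} (ht : 0 < t) (P : H →L[ℂ] H) (hP : ∀ z : ℂ, 0 < z.re → ∀ x, L z (P x) = P (L z x))
    {K : ℝ} (hK : 0 ≤ K)
    (hKP : ∀ s : ℝ, s ≠ 0 → ‖(L ((t⁻¹ : ℝ) + s * I)).comp P‖ ≤ K) :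
    ‖(T t).comp P‖ ≤ 2 * Real.exp 1 * M ^ 2 * K / t := by
  have hM := h.one_le
  apply ContinuousLinearMap.opNorm_le_bound _ (by positivity)
  intro x
  set ε := t⁻¹ with hε
  have hε0 : 0 < ε := by positivity
  obtain ⟨a1, a2, a3⟩ := bct_exp_bound (bctG_meas h ε x) hε0 (bctG_bound h ε x)
  obtain ⟨b1, b2, -⟩ := bct_exp_bound (f := fun t : ℝ => t • bctG T ε (P x) t)
    (continuous_id.aestronglyMeasurable.smul (bctG_meas h ε (P x))) (half_pos hε0)
      (bctG_bound' h hε0 (P x))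
  -- upper bound
  have hup : eLpNorm (bctG T ε x) 2 volume ≤ ENNReal.ofReal (M * ‖x‖ * Real.sqrt (t / 2)) := by
    rw [a2.eLpNorm_eq_integral_rpow_norm (by norm_num) (by norm_num)]
    apply ENNReal.ofReal_le_ofReal
    have e : (∫ a, ‖bctG T ε x a‖ ^ (ENNReal.toReal 2)) = ∫ a, ‖bctG T ε x a‖ ^ 2 := by
      congr 1; ext a; simp
    rw [e]
    have : ((ENNReal.toReal 2)⁻¹ : ℝ) = 1 / 2 := by simp
    rw [this, ← Real.sqrt_eq_rpow]
    rw [Real.sqrt_le_left (by positivity), mul_pow, Real.sq_sqrt (by positivity)]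
    refine a3.trans (le_of_eq ?_)
    rw [hε]; field_simp
  have hmid : eLpNorm (fun τ : ℝ => τ • bctG T ε (P x) τ) 2 volume ≤
      ENNReal.ofReal K * eLpNorm (bctG T ε x) 2 volume := by
    rw [← bct_plancherel _ b1 b2, ← bct_plancherel _ a1 a2]
    apply eLpNorm_le_mul_eLpNorm_of_ae_le_mul
    have h0 : ∀ᵐ w : ℝ, w ≠ 0 := by
      simp [ae_iff]
    filter_upwards [h0] with w hw
    rw [bctG_fourier' h hL hid hε0, bctG_fourier hL hε0]
    have hs : (2 * Real.pi * w) ≠ 0 := by simp [hw, Real.pi_ne_zero]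
    have h1 := hKP _ hs
    push_cast at h1
    rw [hP _ (by simpa using hε0)]
    exact ContinuousLinearMap.le_of_opNorm_le _ h1 _
  have hlow : ENNReal.ofReal (t / 2 * Real.exp (-1) * (‖T t (P x)‖ / M) * Real.sqrt (t / 2)) ≤
      eLpNorm (fun τ : ℝ => τ • bctG T ε (P x) τ) 2 volume := by
    set c := t / 2 * Real.exp (-1) * (‖T t (P x)‖ / M) with hc
    have hc0 : 0 ≤ c := by positivity
    have h1 : eLpNorm ((Set.Ioc (t/2) t).indicator (fun _ : ℝ => c)) 2 volume ≤
        eLpNorm (fun τ : ℝ => τ • bctG T ε (P x) τ) 2 volume := by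
      apply eLpNorm_mono
      intro τ
      by_cases hτ : τ ∈ Set.Ioc (t/2) t
      · rw [Set.indicator_of_mem hτ, Real.norm_of_nonneg hc0, norm_smul]
        have hτ0 : 0 < τ := by linarith [hτ.1]
        have hτm : τ ∈ Set.Ioi (0:ℝ) := hτ0
        rw [Real.norm_of_nonneg hτ0.le]
        simp only [bctG, Set.indicator_of_mem hτm]
        rw [norm_smul, Complex.norm_exp, max_eq_left hτ0.le, hc, mul_assoc]
        have hsg : ‖T t (P x)‖ / M ≤ ‖T τ (P x)‖ := by
          rw [div_le_iff₀ (by linarith), mul_comm]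
          have e := h.add (t - τ) (by linarith [hτ.2]) τ hτ0.le
          rw [show t - τ + τ = t by ring] at e
          rw [e]
          exact h.bdd_apply (by linarith [hτ.2]) _
        have hex : Real.exp (-1) ≤ Real.exp (-(ε:ℂ) * τ).re := by
          apply Real.exp_le_exp.2
          simp only [Complex.mul_re, Complex.neg_re, Complex.ofReal_re, Complex.ofReal_im,
            mul_zero, sub_zero]
          have : ε * τ ≤ ε * t := by gcongr; exact hτ.2
          have h2 : ε * t = 1 := by rw [hε]; field_simp
          linarith
        have := hτ.1.le
        gcongr
      · rw [Set.indicator_of_notMem hτ]; simp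
    refine le_trans (le_of_eq ?_) h1
    rw [eLpNorm_indicator_const measurableSet_Ioc (by norm_num) (by norm_num)]
    rw [Real.volume_Ioc, ENNReal.ofReal_mul hc0]
    congr 1
    · rw [← ofReal_norm, Real.norm_of_nonneg hc0]
    · rw [ENNReal.ofReal_rpow_of_nonneg (by linarith) (by positivity), Real.sqrt_eq_rpow]
      congr 1
      simp
      congr 1
      ring
  have hfin := hlow.trans (hmid.trans (mul_le_mul_right hup _))
  rw [← ENNReal.ofReal_mul hK, ENNReal.ofReal_le_ofReal_iff (by positivity)] at hfin
  have hsq : 0 < Real.sqrt (t / 2) := Real.sqrt_pos.2 (by positivity)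
  have h5 : t / 2 * Real.exp (-1) * (‖T t (P x)‖ / M) ≤ K * (M * ‖x‖) := by
    rw [← mul_le_mul_iff_left₀ hsq]
    linarith
  rw [Real.exp_neg] at h5
  have he := Real.exp_pos 1
  have h6 : t / 2 * (Real.exp 1)⁻¹ * (‖T t (P x)‖ / M) = ‖T t (P x)‖ * t / (2 * Real.exp 1 * M) := by
    field_simp
  rw [h6, div_le_iff₀ (by positivity)] at h5
  simp only [ContinuousLinearMap.comp_apply]
  rw [div_mul_eq_mul_div, le_div_iff₀ ht]
  linarith

end Decay

section Algebra

set_option linter.unusedSectionVars false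

theorem bct_geom {q : ℝ} (hq : 0 < q) {z : ℂ} (hz : z.re ≤ q / 2) :
    q ≤ 2 * ‖(q:ℂ) - z‖ ∧ ‖z‖ ≤ 3 * ‖(q:ℂ) - z‖ := by
  have h1 : q ≤ 2 * ‖(q:ℂ) - z‖ := by
    have := Complex.re_le_norm ((q:ℂ) - z)
    simp at this
    linarith
  refine ⟨h1, ?_⟩
  have h2 : ‖z‖ ≤ ‖(q:ℂ)‖ + ‖(q:ℂ) - z‖ := by
    have := norm_sub_le (q:ℂ) ((q:ℂ) - z)
    simpa using this
  rw [Complex.norm_of_nonneg hq.le] at h2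
  linarith

variable {H : Type*} [NormedAddCommGroup H] [InnerProductSpace ℂ H]

theorem bct_rec {R B D Y : H →L[ℂ] H} {d : ℂ} {δ y : ℝ} (hδ : 1 ≤ δ) (hy : 0 ≤ y)
    (h1 : R * D = d • R + Y) (h2 : D * B = B * D) (hd : ‖d‖ ≤ δ) (hD : ‖D‖ ≤ δ)
    (hY : ‖Y * B‖ ≤ y) (n : ℕ) : ‖R * (B * D ^ n)‖ ≤ ‖d‖ ^ n * ‖R * B‖ + n * y * δ ^ n := by
  induction n with
  | zero => simp
  | succ n ih =>
    have e : R * (B * D ^ (n+1)) = d • (R * (B * D ^ n)) + (Y * B) * D ^ n := by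
      calc R * (B * D ^ (n+1)) = R * ((B * D) * D ^ n) := by rw [pow_succ']; simp only [mul_assoc]
        _ = (R * D) * (B * D ^ n) := by rw [← h2]; simp only [mul_assoc]
        _ = _ := by rw [h1, add_mul, smul_mul_assoc]; simp only [mul_assoc]
    have hDn : ‖D ^ n‖ ≤ δ ^ n := by
      rcases Nat.eq_zero_or_pos n with rfl | hn
      · rw [pow_zero, pow_zero]
        exact ContinuousLinearMap.norm_id_le (𝕜 := ℂ) (E := H)
      · exact (norm_pow_le' D hn).trans (pow_le_pow_left₀ (norm_nonneg _) hD n)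
    rw [e]
    calc ‖d • (R * (B * D ^ n)) + (Y * B) * D ^ n‖
        ≤ ‖d‖ * ‖R * (B * D ^ n)‖ + ‖Y * B‖ * ‖D ^ n‖ := by
          refine (norm_add_le _ _).trans ?_
          rw [norm_smul]
          gcongr
          exact norm_mul_le _ _
      _ ≤ ‖d‖ * (‖d‖ ^ n * ‖R * B‖ + n * y * δ ^ n) + y * δ ^ n := by gcongr
      _ = ‖d‖ ^ (n+1) * ‖R * B‖ + ‖d‖ * (n * y * δ ^ n) + y * δ ^ n := by ring
      _ ≤ ‖d‖ ^ (n+1) * ‖R * B‖ + δ * (n * y * δ ^ n) + δ * (y * δ ^ n) := by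
          have : 0 ≤ y * δ ^ n := by positivity
          have h4 : y * δ ^ n ≤ δ * (y * δ ^ n) := le_mul_of_one_le_left this hδ
          have h5 : ‖d‖ * (n * y * δ ^ n) ≤ δ * (n * y * δ ^ n) := by gcongr
          linarith
      _ = _ := by push_cast; ring

theorem bct_tail {B D : H →L[ℂ] H} {δ η : ℝ} (hδ : 1 ≤ δ) (hη : 0 ≤ η)
    (h : B - B * D = (η:ℂ) • D) (hD : ‖D‖ ≤ δ) (n : ℕ) :
    ‖B - B * D ^ n‖ ≤ η * (n * δ ^ n) := by
  induction n with
  | zero => simp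
  | succ n ih =>
    have e : B - B * D ^ (n+1) = (B - B * D ^ n) + (η:ℂ) • D ^ (n+1) := by
      have : (B - B * D) * D ^ n = (η:ℂ) • D ^ (n+1) := by
        rw [h, smul_mul_assoc, pow_succ']
      rw [← this, sub_mul, pow_succ']; simp only [mul_assoc]; abel
    have hDn : ‖D ^ (n+1)‖ ≤ δ ^ (n+1) :=
      (norm_pow_le' D (Nat.succ_pos n)).trans (pow_le_pow_left₀ (norm_nonneg _) hD _)
    rw [e]
    calc _ ≤ ‖B - B * D ^ n‖ + ‖(η:ℂ) • D ^ (n+1)‖ := norm_add_le _ _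
      _ ≤ η * (n * δ ^ n) + η * δ ^ (n+1) := by
          rw [norm_smul, Complex.norm_of_nonneg hη]; gcongr
      _ ≤ η * (n * δ ^ (n+1)) + η * δ ^ (n+1) := by
          gcongr
          · omega
      _ = _ := by push_cast; ring

set_option maxHeartbeats 2000000 in
/-- Everything about the regularised operator `B D ^ n`. -/
theorem bct_core {L : ℂ → (H →L[ℂ] H)} {M : ℝ} (hM : 1 ≤ M)
    (hn : ∀ z : ℂ, 0 < z.re → ‖L z‖ ≤ M / z.re)
    (hc : ∀ z w : ℂ, 0 < z.re → 0 < w.re → L z * L w = L w * L z)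
    (hid : ∀ z w : ℂ, 0 < z.re → 0 < w.re → L z - L w = (w - z) • (L z * L w))
    {r : ℝ} (hr : 2 ≤ r) (n : ℕ) : ∃ P : H →L[ℂ] H,
      (∀ z : ℂ, 0 < z.re → L z * P = P * L z) ∧
      ‖(L 1 - L 1 * L 1) - P‖ ≤ 4 / r * (n * (9 * M) ^ n) ∧
      ∀ z : ℂ, 0 < z.re → z.re ≤ r⁻¹ / 2 → ∀ W : ℝ, W = max ‖z‖ ‖z‖⁻¹ →
        ‖L z * P‖ ≤ (9 * min 1 (r / W)) ^ n * (9 / W * ‖L z‖ + 8 * M ^ 2)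
          + n * (10 * M ^ 3) * (9 * M) ^ n := by
  set η : ℝ := r⁻¹ with hη
  have hr0 : 0 < r := by linarith
  have hη0 : 0 < η := by positivity
  have hη2 : η ≤ 1 / 2 := by
    rw [hη, inv_le_comm₀ hr0 (by norm_num)]; norm_num; exact hr
  have hrη : r * η = 1 := by rw [hη]; field_simp
  have hrc : (r:ℂ) ≠ 0 := by exact_mod_cast hr0.ne'
  set κ : ℝ := (r - 1) / (r + 1) with hκ
  have hκ0 : 0 ≤ κ := div_nonneg (by linarith) (by linarith)
  have hκ1 : κ ≤ 1 := by rw [hκ, div_le_one (by linarith)]; linarith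
  have r1 : 0 < (1:ℂ).re := by simp
  have rr : 0 < (r:ℂ).re := by simpa using hr0
  have rη : 0 < (η:ℂ).re := by simpa using hη0
  set R1 := L 1 with hR1
  set Rr := L r with hRr
  set Rη := L η with hRη
  set B := R1 - R1 * R1 with hB
  set D := (κ:ℂ) • ((r:ℂ) • Rr - (η:ℂ) • Rη) with hD
  have nR1 : ‖R1‖ ≤ M := by simpa using hn 1 r1
  have nRr : ‖Rr‖ ≤ M / r := by simpa using hn r rr
  have nRη : ‖Rη‖ ≤ M / η := by simpa using hn η rη
  have nB : ‖B‖ ≤ M + M * M := by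
    refine (norm_sub_le _ _).trans ?_
    have := norm_mul_le R1 R1
    have : ‖R1‖ * ‖R1‖ ≤ M * M := by gcongr
    linarith
  have nD : ‖D‖ ≤ 9 * M := by
    rw [hD, norm_smul, Complex.norm_of_nonneg hκ0]
    have h1 : ‖(r:ℂ) • Rr - (η:ℂ) • Rη‖ ≤ M + M := by
      refine (norm_sub_le _ _).trans ?_
      rw [norm_smul, norm_smul, Complex.norm_of_nonneg hr0.le, Complex.norm_of_nonneg hη0.le]
      have e1 : r * ‖Rr‖ ≤ r * (M / r) := by gcongr
      have e2 : η * ‖Rη‖ ≤ η * (M / η) := by gcongr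
      have e3 : r * (M / r) = M := by field_simp
      have e4 : η * (M / η) = M := by field_simp
      linarith
    calc κ * _ ≤ 1 * (M + M) := by gcongr
      _ ≤ _ := by linarith
  -- commutation
  have cB : ∀ z : ℂ, 0 < z.re → Commute (L z) B := fun z hz =>
    have c1 : Commute (L z) R1 := hc z 1 hz r1
    c1.sub_right (c1.mul_right c1)
  have cD : ∀ z : ℂ, 0 < z.re → Commute (L z) D := fun z hz =>
    have c1 : Commute (L z) Rr := hc z r hz rr
    have c2 : Commute (L z) Rη := hc z η hz rη
    ((c1.smul_right _).sub_right (c2.smul_right _)).smul_right _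
  have cDB : D * B = B * D := by
    have c1 : Commute R1 D := cD 1 r1
    exact (c1.symm.sub_right (c1.symm.mul_right c1.symm)).eq
  -- products of resolvents
  have hprod : ∀ z w : ℂ, 0 < z.re → 0 < w.re → w - z ≠ 0 →
      L z * L w = (w - z)⁻¹ • (L z - L w) := by
    intro z w hz hw hzw
    rw [hid z w hz hw, smul_smul, inv_mul_cancel₀ hzw, one_smul]
  have n1 : (r:ℂ) - 1 ≠ 0 := by
    have : r - 1 ≠ 0 := by linarith
    exact_mod_cast this
  have n2 : (r:ℂ) + 1 ≠ 0 := by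
    have : r + 1 ≠ 0 := by linarith
    exact_mod_cast this
  have hηc : (η:ℂ) = (r:ℂ)⁻¹ := by rw [hη]; push_cast; rfl
  have n3 : (η:ℂ) - 1 ≠ 0 := by
    have : η - 1 ≠ 0 := by linarith
    exact_mod_cast this
  have p1 : R1 * Rr = ((r:ℂ) - 1)⁻¹ • (R1 - Rr) := hprod 1 r r1 rr n1
  have p2 : R1 * Rη = ((η:ℂ) - 1)⁻¹ • (R1 - Rη) := hprod 1 η r1 rη n3
  have hi3 : ((η:ℂ) - 1)⁻¹ = - ((r:ℂ) * ((r:ℂ) - 1)⁻¹) := by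
    have : (1:ℂ) - r ≠ 0 := by
      intro h; apply n1; linear_combination -h
    rw [hηc]; field_simp; ring
  rw [hi3] at p2
  have hκc : (κ:ℂ) = ((r:ℂ) - 1) * ((r:ℂ) + 1)⁻¹ := by rw [hκ]; push_cast; rfl
  set η' : ℝ := r / (r - 1) ^ 2 with hη'
  have hη'c : (η':ℂ) = (r:ℂ) / ((r:ℂ) - 1) ^ 2 := by rw [hη']; push_cast; rfl
  have keyBD : B - B * D = (η':ℂ) • D := by
    have q1 : R1 * D = R1 - ((r:ℂ) + 1)⁻¹ • ((r:ℂ) • Rr + Rη) := by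
      rw [hD, mul_smul_comm, mul_sub, mul_smul_comm, mul_smul_comm, p1, p2, hκc, hηc]
      match_scalars <;> field_simp <;> ring
    have q2 : R1 * R1 * D = R1 * R1 - ((r:ℂ) * ((r:ℂ) + 1)⁻¹ * ((r:ℂ) - 1)⁻¹) • (Rη - Rr) := by
      rw [mul_assoc, q1, mul_sub, mul_smul_comm, mul_add, mul_smul_comm, p1, p2]
      match_scalars <;> field_simp <;> ring
    rw [hB, sub_mul, q1, q2, hD, hκc, hη'c, hηc]
    match_scalars <;> field_simp <;> ring
  have hη'0 : 0 ≤ η' := div_nonneg hr0.le (by positivity)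
  have hη'le : η' ≤ 4 / r := by
    rw [hη', div_le_div_iff₀ (by nlinarith) hr0]
    nlinarith
  refine ⟨B * D ^ n, ?_, ?_, ?_⟩
  · intro z hz
    exact ((cB z hz).mul_right ((cD z hz).pow_right n)).eq
  · refine (bct_tail (by linarith) hη'0 keyBD nD n).trans ?_
    gcongr
  · intro z hz hzr W hW
    set Rz := L z with hRz
    obtain ⟨g1, g2⟩ := bct_geom hr0 (z := z) (by linarith)
    obtain ⟨g3, g4⟩ := bct_geom hη0 (z := z) hzr
    obtain ⟨g5, g6⟩ := bct_geom one_pos (z := z) (by linarith)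
    rw [Complex.ofReal_one] at g5 g6
    have a1 : 0 < ‖(r:ℂ) - z‖ := by linarith
    have a2 : 0 < ‖(η:ℂ) - z‖ := by linarith
    have a3 : 0 < ‖(1:ℂ) - z‖ := by linarith
    have m1 : (r:ℂ) - z ≠ 0 := norm_pos_iff.1 a1
    have m2 : (η:ℂ) - z ≠ 0 := norm_pos_iff.1 a2
    have m3 : (1:ℂ) - z ≠ 0 := norm_pos_iff.1 a3
    have hz0 : z ≠ 0 := by rintro rfl; simp at hz
    have hρ : 0 < ‖z‖ := norm_pos_iff.2 hz0
    have hW1 : ‖z‖ ≤ W := hW ▸ le_max_left _ _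
    have hW2 : ‖z‖⁻¹ ≤ W := hW ▸ le_max_right _ _
    have hW0 : 0 < W := hρ.trans_le hW1
    set d : ℂ := κ * (r / (r - z) - η / (η - z)) with hd
    set Y : H →L[ℂ] H := (κ:ℂ) • ((η / (η - z) : ℂ) • Rη - (r / (r - z) : ℂ) • Rr) with hY
    have pr : Rz * Rr = ((r:ℂ) - z)⁻¹ • (Rz - Rr) := hprod z r hz rr m1
    have pη : Rz * Rη = ((η:ℂ) - z)⁻¹ • (Rz - Rη) := hprod z η hz rη m2
    have p1z : Rz * R1 = ((1:ℂ) - z)⁻¹ • (Rz - R1) := hprod z 1 hz r1 m3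
    have hRD : Rz * D = d • Rz + Y := by
      rw [hD, mul_smul_comm, mul_sub, mul_smul_comm, mul_smul_comm, pr, pη, hd, hY]
      match_scalars <;> field_simp
    -- bound on d
    have hdn : ‖d‖ ≤ ‖z‖ * r / (‖(r:ℂ) - z‖ * ‖(η:ℂ) - z‖) := by
      have e : d = (κ:ℂ) * (-z * ((r - η : ℝ) : ℂ) / ((r - z) * (η - z))) := by
        rw [hd]; push_cast; field_simp; ring
      rw [e, norm_mul, norm_div, norm_mul, norm_mul, norm_neg, Complex.norm_of_nonneg hκ0,
        Complex.norm_of_nonneg (by linarith : (0:ℝ) ≤ r - η)]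
      calc κ * (‖z‖ * (r - η) / (‖(r:ℂ) - z‖ * ‖(η:ℂ) - z‖))
          ≤ 1 * (‖z‖ * r / (‖(r:ℂ) - z‖ * ‖(η:ℂ) - z‖)) := by
            have h1 : ‖z‖ * (r - η) / (‖(r:ℂ) - z‖ * ‖(η:ℂ) - z‖) ≤
                ‖z‖ * r / (‖(r:ℂ) - z‖ * ‖(η:ℂ) - z‖) := by
              gcongr
              linarith
            exact mul_le_mul hκ1 h1 (div_nonneg (mul_nonneg hρ.le (by linarith)) (by positivity))
              zero_le_one
        _ = _ := one_mul _
    have hd1 : ‖d‖ ≤ 9 := by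
      refine hdn.trans ?_
      rw [div_le_iff₀ (by positivity)]
      have : ‖z‖ * r ≤ (3 * ‖(η:ℂ) - z‖) * (2 * ‖(r:ℂ) - z‖) := by gcongr
      have h3 : 0 ≤ ‖(r:ℂ) - z‖ * ‖(η:ℂ) - z‖ := by positivity
      linarith
    have hd2 : ‖d‖ ≤ 9 * (r / W) := by
      refine hdn.trans ?_
      rw [hW]
      rcases le_total ‖z‖ ‖z‖⁻¹ with h | h
      · rw [max_eq_right h, div_le_iff₀ (by positivity)]
        have h1 : r * η ≤ (2 * ‖(r:ℂ) - z‖) * (2 * ‖(η:ℂ) - z‖) := by gcongr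
        rw [hrη] at h1
        rw [div_inv_eq_mul]
        have h2 : ‖z‖ * r * 1 ≤ ‖z‖ * r * ((2 * ‖(r:ℂ) - z‖) * (2 * ‖(η:ℂ) - z‖)) := by gcongr
        have h3 : 0 ≤ r * ‖z‖ * (‖(r:ℂ) - z‖ * ‖(η:ℂ) - z‖) := by positivity
        linarith
      · rw [max_eq_left h, div_le_iff₀ (by positivity)]
        have h1 : ‖z‖ * ‖z‖ ≤ (3 * ‖(r:ℂ) - z‖) * (3 * ‖(η:ℂ) - z‖) := by gcongr
        have e : 9 * (r / ‖z‖) * (‖(r:ℂ) - z‖ * ‖(η:ℂ) - z‖) =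
          r * ((3 * ‖(r:ℂ) - z‖) * (3 * ‖(η:ℂ) - z‖)) / ‖z‖ := by field_simp; ring
        rw [e, le_div_iff₀ hρ]
        have h2 : r * (‖z‖ * ‖z‖) ≤ r * ((3 * ‖(r:ℂ) - z‖) * (3 * ‖(η:ℂ) - z‖)) := by gcongr
        linarith
    have hd3 : ‖d‖ ≤ 9 * min 1 (r / W) := by
      rcases le_total 1 (r / W) with h | h
      · rw [min_eq_left h]; linarith
      · rw [min_eq_right h]; exact hd2
    -- bound on Y * B
    have nη : ‖Rη * B‖ ≤ 4 * M ^ 2 := by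
      have e : Rη * B = ((1:ℂ) - η)⁻¹ • ((R1 - (η:ℂ) • Rη) * R1) := by
        have hη1 : Rη * R1 = ((1:ℂ) - η)⁻¹ • (Rη - R1) :=
          hprod η 1 rη r1 (by intro h; apply n3; linear_combination -h)
        have : (1:ℂ) - η ≠ 0 := by intro h; apply n3; linear_combination -h
        rw [hB, mul_sub, ← mul_assoc, sub_mul, smul_mul_assoc, hη1, smul_mul_assoc, sub_mul, hη1]
        match_scalars <;> field_simp <;> ring
      rw [e, norm_smul, norm_inv]
      have h1 : (1:ℝ) / 2 ≤ ‖(1:ℂ) - η‖ := by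
        have := Complex.re_le_norm ((1:ℂ) - η)
        simp at this
        linarith
      have h2 : ‖(1:ℂ) - η‖⁻¹ ≤ 2 := by
        rw [inv_le_comm₀ (by linarith) (by norm_num)]; linarith
      have h3 : ‖(R1 - (η:ℂ) • Rη) * R1‖ ≤ (M + M) * M := by
        refine (norm_mul_le _ _).trans ?_
        gcongr
        refine (norm_sub_le _ _).trans ?_
        rw [norm_smul, Complex.norm_of_nonneg hη0.le]
        have e2 : η * ‖Rη‖ ≤ η * (M / η) := by gcongr
        have e4 : η * (M / η) = M := by field_simp
        linarith
      calc _ ≤ 2 * ((M + M) * M) := by gcongr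
        _ = _ := by ring
    have nr : ‖Rr * B‖ ≤ M ^ 3 := by
      refine (norm_mul_le _ _).trans ?_
      have h1 : ‖Rr‖ ≤ M / 2 := nRr.trans (by gcongr)
      calc ‖Rr‖ * ‖B‖ ≤ M / 2 * (M + M * M) := by gcongr
        _ ≤ M ^ 3 := by nlinarith [mul_nonneg (by linarith : 0 ≤ M) (by linarith : 0 ≤ M)]
    have nY : ‖Y * B‖ ≤ 10 * M ^ 3 := by
      have e : Y * B = (κ:ℂ) • ((η / (η - z) : ℂ) • (Rη * B) - (r / (r - z) : ℂ) • (Rr * B)) := by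
        rw [hY, smul_mul_assoc, sub_mul, smul_mul_assoc, smul_mul_assoc]
      rw [e, norm_smul, Complex.norm_of_nonneg hκ0]
      have h1 : ‖(η / (η - z) : ℂ)‖ ≤ 2 := by
        rw [norm_div, Complex.norm_of_nonneg hη0.le, div_le_iff₀ a2]; exact g3
      have h2 : ‖(r / (r - z) : ℂ)‖ ≤ 2 := by
        rw [norm_div, Complex.norm_of_nonneg hr0.le, div_le_iff₀ a1]; exact g1
      have h3 : ‖(η / (η - z) : ℂ) • (Rη * B) - (r / (r - z) : ℂ) • (Rr * B)‖ ≤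
          2 * (4 * M ^ 2) + 2 * M ^ 3 := by
        refine (norm_sub_le _ _).trans ?_
        rw [norm_smul, norm_smul]
        gcongr
      calc _ ≤ 1 * (2 * (4 * M ^ 2) + 2 * M ^ 3) := by gcongr
        _ ≤ _ := by nlinarith [sq_nonneg M]
    have hrec := bct_rec (δ := 9 * M) (by linarith) (by positivity) hRD cDB (by linarith) nD nY n
    -- bound on Rz * B
    have nRB : ‖Rz * B‖ ≤ 9 / W * ‖Rz‖ + 8 * M ^ 2 := by
      set u : ℂ := (1 - z)⁻¹ with hu
      have e : Rz * B = (-z * u ^ 2) • Rz + ((u ^ 2 - u) • R1 + u • (R1 * R1)) := by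
        rw [hB, mul_sub, ← mul_assoc, p1z, smul_mul_assoc, sub_mul, p1z]
        have : z = 1 - u⁻¹ := by rw [hu]; simp
        have hu0 : u ≠ 0 := inv_ne_zero m3
        match_scalars <;> first | ring1 | (rw [this]; field_simp; ring)
      have hun : ‖u‖ = ‖(1:ℂ) - z‖⁻¹ := by rw [hu, norm_inv]
      have hu2 : ‖u‖ ≤ 2 := by
        rw [hun, inv_le_comm₀ a3 (by norm_num)]; linarith
      have hb : ‖-z * u ^ 2‖ ≤ 9 / W := by
        rw [norm_mul, norm_neg, norm_pow, hun, hW]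
        rcases le_total ‖z‖ ‖z‖⁻¹ with h | h
        · rw [max_eq_right h, div_inv_eq_mul, mul_comm]
          gcongr
          rw [← hun]; nlinarith [norm_nonneg u]
        · rw [max_eq_left h, inv_pow, ← div_eq_mul_inv, div_le_div_iff₀ (by positivity) hρ]
          have h2 : ‖z‖ * ‖z‖ ≤ (3 * ‖(1:ℂ) - z‖) * (3 * ‖(1:ℂ) - z‖) := by gcongr
          linarith
      rw [e]
      refine (norm_add_le _ _).trans ?_
      rw [norm_smul]
      refine add_le_add (by gcongr) ?_
      refine (norm_add_le _ _).trans ?_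
      rw [norm_smul, norm_smul]
      have h1 : ‖u ^ 2 - u‖ ≤ 6 := by
        refine (norm_sub_le _ _).trans ?_
        rw [norm_pow]; nlinarith [norm_nonneg u]
      have h2 : ‖R1 * R1‖ ≤ M * M := (norm_mul_le _ _).trans (by gcongr)
      calc _ ≤ 6 * M + 2 * (M * M) := by gcongr
        _ ≤ _ := by nlinarith
    refine hrec.trans ?_
    gcongr

end Algebra

section Bounds

set_option linter.unusedSectionVars false

variable {H : Type*} [NormedAddCommGroup H] [InnerProductSpace ℂ H] [CompleteSpace H]

theorem bct_id_norm {A : H →ₗ.[ℂ] H} {z w : ℂ} {R S : H →L[ℂ] H}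
    (hz : IsResolventAt A z R) (hw : IsResolventAt A w S) :
    ‖R‖ ≤ ‖S‖ + ‖w - z‖ * ‖R‖ * ‖S‖ := by
  have e : R = S + (w - z) • (R.comp S) := by
    ext x
    have := hz.identity hw x
    simp only [add_apply, smul_apply,
      ContinuousLinearMap.comp_apply, ← this]
    abel
  calc ‖R‖ = ‖S + (w - z) • (R.comp S)‖ := by rw [← e]
    _ ≤ ‖S‖ + ‖(w - z) • (R.comp S)‖ := norm_add_le _ _
    _ ≤ ‖S‖ + ‖w - z‖ * (‖R‖ * ‖S‖) := by
        rw [norm_smul]; gcongr; exact R.opNorm_comp_le S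
    _ = _ := by ring

theorem bct_mid {A : H →ₗ.[ℂ] H}
    (himres : ∀ s : ℝ, s ≠ 0 → ∃ R : H →L[ℂ] H, IsResolventAt A (Complex.I * s) R)
    {δ Λ : ℝ} (hδ : 0 < δ) :
    ∃ C ≥ (0:ℝ), ∀ s : ℝ, δ ≤ |s| → |s| ≤ Λ → ∀ R : H →L[ℂ] H,
      IsResolventAt A (Complex.I * s) R → ‖R‖ ≤ C := by
  have hK : IsCompact {s : ℝ | δ ≤ |s| ∧ |s| ≤ Λ} := by
    refine Metric.isCompact_of_isClosed_isBounded ?_ ?_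
    · exact (isClosed_le continuous_const continuous_abs).inter
        (isClosed_le continuous_abs continuous_const)
    · refine (Metric.isBounded_Icc (-Λ) Λ).subset ?_
      rintro s ⟨-, h⟩
      exact abs_le.1 h
  have key : ∃ C ≥ (0:ℝ), ∀ s ∈ {s : ℝ | δ ≤ |s| ∧ |s| ≤ Λ}, ∀ R : H →L[ℂ] H,
      IsResolventAt A (Complex.I * s) R → ‖R‖ ≤ C := by
    refine hK.induction_on (p := fun S => ∃ C ≥ (0:ℝ), ∀ s ∈ S, ∀ R : H →L[ℂ] H,
      IsResolventAt A (Complex.I * (s:ℝ)) R → ‖R‖ ≤ C) ?_ ?_ ?_ ?_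
    · exact ⟨0, le_rfl, by simp⟩
    · rintro s t hst ⟨C, hC, h⟩
      exact ⟨C, hC, fun x hx => h x (hst hx)⟩
    · rintro s t ⟨C, hC, h⟩ ⟨D, hD, h'⟩
      refine ⟨max C D, le_max_of_le_left hC, ?_⟩
      rintro x (hx | hx) R hR
      · exact (h x hx R hR).trans (le_max_left _ _)
      · exact (h' x hx R hR).trans (le_max_right _ _)
    · rintro s₀ ⟨h1, -⟩
      have h0 : s₀ ≠ 0 := by
        rintro rfl
        simp at h1; linarith
      obtain ⟨S, hS⟩ := himres s₀ h0
      have hpos : 0 < 1 / (2 * (‖S‖ + 1)) := by positivity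
      refine ⟨Metric.ball s₀ (1 / (2 * (‖S‖ + 1))), mem_nhdsWithin_of_mem_nhds
        (Metric.ball_mem_nhds _ hpos), 2 * ‖S‖, by positivity, ?_⟩
      intro s hs R hR
      have h2 := bct_id_norm hR hS
      have h3 : ‖Complex.I * (s₀:ℂ) - Complex.I * s‖ = |s - s₀| := by
        rw [← mul_sub, norm_mul, Complex.norm_I, one_mul, ← Complex.ofReal_sub, Complex.norm_real,
          Real.norm_eq_abs, abs_sub_comm]
      rw [h3] at h2
      rw [Metric.mem_ball, Real.dist_eq] at hs
      have h4 : |s - s₀| * ‖S‖ ≤ 1 / 2 := by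
        calc |s - s₀| * ‖S‖ ≤ 1 / (2 * (‖S‖ + 1)) * (‖S‖ + 1) := by
              gcongr; linarith
          _ = 1 / 2 := by field_simp
      nlinarith [norm_nonneg R, mul_le_mul_of_nonneg_right h4 (norm_nonneg R)]
  obtain ⟨C, hC, h⟩ := key
  exact ⟨C, hC, fun s h1 h2 => h s ⟨h1, h2⟩⟩

theorem bct_imag_bound {A : H →ₗ.[ℂ] H}
    (himres : ∀ s : ℝ, s ≠ 0 → ∃ R : H →L[ℂ] H, IsResolventAt A (Complex.I * s) R)
    (l k : ℝ)
    (hres0 : ∃ C₁ > (0:ℝ), ∃ δ > (0:ℝ), ∀ s : ℝ, s ≠ 0 → |s| < δ →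
      ∀ R : H →L[ℂ] H, IsResolventAt A (Complex.I * s) R → ‖R‖ ≤ C₁ * |s| ^ (-l))
    (hresInf : ∃ C₂ > (0:ℝ), ∃ Λ : ℝ, ∀ s : ℝ, Λ ≤ |s| →
      ∀ R : H →L[ℂ] H, IsResolventAt A (Complex.I * s) R → ‖R‖ ≤ C₂ * |s| ^ k)
    (hl : 1 ≤ l) (hk : 0 < k) :
    ∃ C ≥ (0:ℝ), ∀ s : ℝ, s ≠ 0 → ∀ R : H →L[ℂ] H,
      IsResolventAt A (Complex.I * s) R → ‖R‖ ≤ C * (max |s| |s|⁻¹) ^ (max l k) := by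
  obtain ⟨C₁, hC₁, δ, hδ, h1⟩ := hres0
  obtain ⟨C₂, hC₂, Λ, h2⟩ := hresInf
  obtain ⟨C, hC, h3⟩ := bct_mid himres (Λ := Λ) hδ
  refine ⟨C₁ + C₂ + C, by positivity, ?_⟩
  intro s hs R hR
  have hs0 : 0 < |s| := abs_pos.2 hs
  set w := max |s| |s|⁻¹ with hw
  have hw1 : 1 ≤ w := by
    rcases le_total 1 |s| with h | h
    · exact h.trans (le_max_left _ _)
    · exact ((one_le_inv₀ hs0).2 h).trans (le_max_right _ _)
  have hw0 : 0 < w := by linarith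
  have hwa : 1 ≤ w ^ (max l k) := Real.one_le_rpow hw1 (by
    have := le_max_left l k; linarith)
  rcases lt_or_ge |s| δ with h | h
  · have : |s| ^ (-l) ≤ w ^ (max l k) := by
      rw [Real.rpow_neg hs0.le, ← Real.inv_rpow hs0.le]
      calc (|s|⁻¹) ^ l ≤ w ^ l := by gcongr; exact le_max_right _ _
        _ ≤ _ := Real.rpow_le_rpow_of_exponent_le hw1 (le_max_left _ _)
    have := h1 s hs h R hR
    nlinarith
  rcases le_or_gt Λ |s| with h' | h'
  · have : |s| ^ k ≤ w ^ (max l k) := by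
      calc |s| ^ k ≤ w ^ k := by gcongr; exact le_max_left _ _
        _ ≤ _ := Real.rpow_le_rpow_of_exponent_le hw1 (le_max_right _ _)
    have := h2 s h' R hR
    nlinarith
  · have := h3 s h h'.le R hR
    nlinarith

theorem bct_right_bound {A : H →ₗ.[ℂ] H} {L : ℂ → (H →L[ℂ] H)} {M : ℝ} (hM : 1 ≤ M)
    (hn : ∀ z : ℂ, 0 < z.re → ‖L z‖ ≤ M / z.re)
    (hres : ∀ z : ℂ, 0 < z.re → IsResolventAt A z (L z))
    (himres : ∀ s : ℝ, s ≠ 0 → ∃ R : H →L[ℂ] H, IsResolventAt A (Complex.I * s) R)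
    {a C : ℝ} (ha : 1 ≤ a) (hC : 0 ≤ C)
    (hb : ∀ s : ℝ, s ≠ 0 → ∀ R : H →L[ℂ] H,
      IsResolventAt A (Complex.I * s) R → ‖R‖ ≤ C * (max |s| |s|⁻¹) ^ a)
    (z : ℂ) (hz : 0 < z.re) (hzi : z.im ≠ 0) :
    ‖L z‖ ≤ ((1 + M) * (C * 2 ^ a) + 2 * M) * (max ‖z‖ ‖z‖⁻¹) ^ a := by
  have hz0 : 0 < ‖z‖ := hz.trans_le (Complex.re_le_norm z)
  set W := max ‖z‖ ‖z‖⁻¹ with hW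
  have hW1 : 1 ≤ W := by
    rcases le_total 1 ‖z‖ with h | h
    · exact h.trans (le_max_left _ _)
    · exact ((one_le_inv₀ hz0).2 h).trans (le_max_right _ _)
  have hWa : 0 ≤ W ^ a := by positivity
  have hsum := Complex.norm_le_abs_re_add_abs_im z
  rw [abs_of_pos hz] at hsum
  have hi0 : 0 < |z.im| := abs_pos.2 hzi
  have h2a : 0 ≤ (1 + M) * (C * 2 ^ a) := by positivity
  rcases le_or_gt z.re |z.im| with h | h
  · obtain ⟨R, hR⟩ := himres z.im hzi
    have h1 := bct_id_norm (hres z hz) hR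
    have h2 : ‖Complex.I * (z.im:ℂ) - z‖ = z.re := by
      have : Complex.I * (z.im:ℂ) - z = -(z.re:ℂ) := by
        apply Complex.ext <;> simp
      rw [this, norm_neg, Complex.norm_of_nonneg hz.le]
    rw [h2] at h1
    have h3 : z.re * ‖L z‖ ≤ M := by
      have := hn z hz
      rw [le_div_iff₀ hz] at this
      linarith
    have h4 : ‖L z‖ ≤ (1 + M) * ‖R‖ := by
      nlinarith [mul_le_mul_of_nonneg_right h3 (norm_nonneg R)]
    have h5 : max |z.im| |z.im|⁻¹ ≤ 2 * W := by
      refine max_le ?_ ?_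
      · have := Complex.abs_im_le_norm z
        have := le_max_left ‖z‖ ‖z‖⁻¹
        linarith
      · have h6 : |z.im|⁻¹ ≤ 2 * ‖z‖⁻¹ := by
          rw [← div_eq_mul_inv, inv_le_comm₀ hi0 (by positivity), inv_div]
          linarith
        have := le_max_right ‖z‖ ‖z‖⁻¹
        linarith
    have h7 : (max |z.im| |z.im|⁻¹) ^ a ≤ 2 ^ a * W ^ a := by
      rw [← Real.mul_rpow (by norm_num) (by linarith)]
      gcongr
    calc ‖L z‖ ≤ (1 + M) * ‖R‖ := h4
      _ ≤ (1 + M) * (C * (2 ^ a * W ^ a)) := by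
          gcongr
          exact (hb _ hzi R hR).trans (by gcongr)
      _ = (1 + M) * (C * 2 ^ a) * W ^ a := by ring
      _ ≤ _ := by gcongr; linarith
  · have h1 : ‖L z‖ ≤ 2 * M * ‖z‖⁻¹ := by
      refine (hn z hz).trans ?_
      rw [div_le_iff₀ hz]
      have : 1 ≤ ‖z‖⁻¹ * z.re * 2 := by
        rw [mul_assoc, inv_mul_eq_div, le_div_iff₀ hz0]; linarith
      nlinarith
    have h2 : ‖z‖⁻¹ ≤ W ^ a := by
      calc ‖z‖⁻¹ ≤ W := le_max_right _ _
        _ = W ^ (1:ℝ) := (Real.rpow_one _).symm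
        _ ≤ _ := Real.rpow_le_rpow_of_exponent_le hW1 ha
    calc ‖L z‖ ≤ 2 * M * ‖z‖⁻¹ := h1
      _ ≤ 2 * M * W ^ a := by gcongr
      _ ≤ _ := by gcongr; linarith

theorem bct_min_pow {r W a : ℝ} (hr : 0 < r) (hW : 1 ≤ W) (ha : 1 ≤ a) {n : ℕ} (hn : a ≤ n) :
    (min 1 (r / W)) ^ n * W ^ (a - 1) ≤ r ^ (a - 1) := by
  have hW0 : 0 < W := by linarith
  rcases le_or_gt W r with h | h
  · calc (min 1 (r / W)) ^ n * W ^ (a - 1) ≤ 1 * r ^ (a - 1) := by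
          gcongr
          exact pow_le_one₀ (le_min zero_le_one (by positivity)) (min_le_left _ _)
      _ = _ := one_mul _
  · have h1 : r / W ≤ 1 := by rw [div_le_one hW0]; exact h.le
    rw [min_eq_right h1, ← Real.rpow_natCast]
    calc (r / W) ^ (n:ℝ) * W ^ (a - 1) ≤ (r / W) ^ (a - 1) * W ^ (a - 1) := by
          gcongr ?_ * _
          exact Real.rpow_le_rpow_of_exponent_ge (by positivity) h1 (by linarith)
      _ = _ := by
          rw [← Real.mul_rpow (by positivity) hW0.le, div_mul_cancel₀ _ hW0.ne']

end Bounds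
section Final

set_option linter.unusedSectionVars false

variable {H : Type*} [NormedAddCommGroup H] [InnerProductSpace ℂ H] [CompleteSpace H]

theorem bct_large {T : ℝ → (H →L[ℂ] H)} {M : ℝ} (h : BctSemi T M) {L : ℂ → (H →L[ℂ] H)}
    (hL : BctLap T L) (hn : ∀ z : ℂ, 0 < z.re → ‖L z‖ ≤ M / z.re)
    (hid : ∀ z w : ℂ, 0 < z.re → 0 < w.re → ∀ x, L z x - L w x = (w - z) • L z (L w x))
    {a C₀ : ℝ} (ha : 1 ≤ a) (hC₀ : 0 ≤ C₀)
    (hb : ∀ z : ℂ, 0 < z.re → z.im ≠ 0 → ‖L z‖ ≤ C₀ * (max ‖z‖ ‖z‖⁻¹) ^ a) :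
    ∃ C ≥ (0:ℝ), ∀ t : ℝ, 4 ≤ t ^ (1 / a) → 1 ≤ t →
      ‖(T t).comp (L 1 - L 1 * L 1)‖ ≤ C * t ^ (-(1 / a)) := by
  have hM := h.one_le
  have hc : ∀ z w : ℂ, 0 < z.re → 0 < w.re → L z * L w = L w * L z := by
    intro z w hz hw
    ext x
    exact hL.comm h hz hw x
  have hid' : ∀ z w : ℂ, 0 < z.re → 0 < w.re → L z - L w = (w - z) • (L z * L w) := by
    intro z w hz hw
    ext x
    exact hid z w hz hw x
  set n : ℕ := ⌈a⌉₊ with hnn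
  have han : a ≤ n := Nat.le_ceil a
  set K₀ : ℝ := 9 ^ n * (9 * C₀) + 9 ^ n * (8 * M ^ 2) + n * (10 * M ^ 3) * (9 * M) ^ n with hK₀
  have hK₀0 : 0 ≤ K₀ := by positivity
  refine ⟨2 * Real.exp 1 * M ^ 2 * K₀ + M * (8 * (n * (9 * M) ^ n)), by positivity, ?_⟩
  intro t ht4 ht1
  have ht0 : 0 < t := by linarith
  have ha0 : 0 < a := by linarith
  set r : ℝ := t ^ (1 / a) / 2 with hrdef
  have hr : 2 ≤ r := by rw [hrdef]; linarith
  have hr0 : 0 < r := by linarith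
  have hrt : t ^ (1 / a) ≤ t := by
    calc t ^ (1 / a) ≤ t ^ (1:ℝ) := Real.rpow_le_rpow_of_exponent_le ht1 (by
          rw [div_le_one ha0]; exact ha)
      _ = t := Real.rpow_one t
  obtain ⟨P, hPc, hPB, hPz⟩ := bct_core hM hn hc hid' hr n
  have hra : 1 ≤ r ^ (a - 1) := Real.one_le_rpow (by linarith) (by linarith)
  have hKP : ∀ s : ℝ, s ≠ 0 → ‖(L ((t⁻¹ : ℝ) + s * I)).comp P‖ ≤ K₀ * r ^ (a - 1) := by
    intro s hs
    set z : ℂ := (t⁻¹ : ℝ) + s * I with hz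
    have hre : z.re = t⁻¹ := by simp [hz]
    have him : z.im = s := by simp [hz]
    have hre0 : 0 < z.re := by rw [hre]; positivity
    have hrele : z.re ≤ r⁻¹ / 2 := by
      rw [hre, hrdef, inv_div, div_div, mul_comm, ← div_div, div_self (by norm_num), one_div]
      gcongr
    have h1 := hPz z hre0 hrele _ rfl
    have h2 := hb z hre0 (by rw [him]; exact hs)
    have hz0 : 0 < ‖z‖ := hre0.trans_le (Complex.re_le_norm z)
    set W := max ‖z‖ ‖z‖⁻¹ with hW
    have hW1 : 1 ≤ W := by
      rcases le_total 1 ‖z‖ with h | h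
      · exact h.trans (le_max_left _ _)
      · exact ((one_le_inv₀ hz0).2 h).trans (le_max_right _ _)
    have hW0 : 0 < W := by linarith
    have h3 : 9 / W * ‖L z‖ ≤ 9 * C₀ * W ^ (a - 1) := by
      calc 9 / W * ‖L z‖ ≤ 9 / W * (C₀ * W ^ a) := by gcongr
        _ = _ := by rw [Real.rpow_sub_one hW0.ne']; ring
    have hm0 : 0 ≤ min 1 (r / W) := le_min zero_le_one (by positivity)
    have hm1 : (min 1 (r / W)) ^ n ≤ 1 := pow_le_one₀ hm0 (min_le_left _ _)
    have h4 := bct_min_pow hr0 hW1 ha han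
    refine h1.trans ?_
    calc (9 * min 1 (r / W)) ^ n * (9 / W * ‖L z‖ + 8 * M ^ 2) + n * (10 * M ^ 3) * (9 * M) ^ n
        ≤ (9 * min 1 (r / W)) ^ n * (9 * C₀ * W ^ (a - 1) + 8 * M ^ 2)
          + n * (10 * M ^ 3) * (9 * M) ^ n := by gcongr
      _ = 9 ^ n * (9 * C₀) * ((min 1 (r / W)) ^ n * W ^ (a - 1))
          + 9 ^ n * (8 * M ^ 2) * (min 1 (r / W)) ^ n + n * (10 * M ^ 3) * (9 * M) ^ n * 1 := by
          rw [mul_pow]; ring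
      _ ≤ 9 ^ n * (9 * C₀) * r ^ (a - 1)
          + 9 ^ n * (8 * M ^ 2) * r ^ (a - 1) + n * (10 * M ^ 3) * (9 * M) ^ n * r ^ (a - 1) := by
          gcongr
          exact hm1.trans hra
      _ = K₀ * r ^ (a - 1) := by rw [hK₀]; ring
  have hd := bct_decay h hL hid ht0 P (fun z hz x => congrArg (fun S : H →L[ℂ] H => S x) (hPc z hz))
    (by positivity) hKP
  have hrt2 : r ^ (a - 1) / t ≤ t ^ (-(1 / a)) := by
    rw [div_le_iff₀ ht0]
    calc r ^ (a - 1) ≤ (t ^ (1 / a)) ^ (a - 1) := by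
          gcongr
          rw [hrdef]; linarith
      _ = t ^ (-(1 / a) + 1) := by
          rw [← Real.rpow_mul ht0.le]
          congr 1
          field_simp
          ring
      _ = _ := by rw [Real.rpow_add_one ht0.ne']
  have hri : 4 / r = 8 * t ^ (-(1 / a)) := by
    rw [hrdef, Real.rpow_neg ht0.le]
    field_simp
    norm_num
  have e : (T t).comp (L 1 - L 1 * L 1) = (T t).comp P + (T t).comp ((L 1 - L 1 * L 1) - P) := by
    rw [← ContinuousLinearMap.comp_add]; congr 1; abel
  rw [e]
  calc _ ≤ ‖(T t).comp P‖ + ‖(T t).comp ((L 1 - L 1 * L 1) - P)‖ := norm_add_le _ _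
    _ ≤ 2 * Real.exp 1 * M ^ 2 * (K₀ * r ^ (a - 1)) / t + M * (4 / r * (n * (9 * M) ^ n)) := by
        gcongr
        refine (ContinuousLinearMap.opNorm_comp_le _ _).trans ?_
        gcongr
        exact h.bdd t ht0.le
    _ = 2 * Real.exp 1 * M ^ 2 * K₀ * (r ^ (a - 1) / t) + M * (4 / r * (n * (9 * M) ^ n)) := by
        ring
    _ ≤ 2 * Real.exp 1 * M ^ 2 * K₀ * t ^ (-(1 / a))
        + M * (8 * t ^ (-(1 / a)) * (n * (9 * M) ^ n)) := by
        rw [hri]; gcongr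
    _ = _ := by ring

end Final

/-- **Batty–Chill–Tomilov, singular-at-zero version.**  Let `A` generate
a bounded `C₀`-semigroup `(T(t))` on a Hilbert space with `σ(A) ∩ iℝ = {0}`, and
suppose `‖(is − A)⁻¹‖ = O(|s|^{−l})` as `s → 0` and `= O(|s|^k)` as `|s| → ∞`, for
some `l ≥ 1`, `k > 0`.  Then `‖T(t)A(I − A)⁻²‖ = O(t^{−1/a})` with `a = max{l, k}`,
where `A(I − A)⁻² = (I − A)⁻¹∘(I − A)⁻¹ − (I − A)⁻¹` is bounded. -/
theorem batty_chill_tomilov_decay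
    {H : Type*} [NormedAddCommGroup H] [InnerProductSpace ℂ H] [CompleteSpace H]
    (A : H →ₗ.[ℂ] H) (T : ℝ → (H →L[ℂ] H))
    -- `(T(t))_{t ≥ 0}` is a bounded `C₀`-semigroup
    (hsemi0 : T 0 = ContinuousLinearMap.id ℂ H)
    (hsemi : ∀ s ≥ (0:ℝ), ∀ t ≥ (0:ℝ), T (s + t) = (T s).comp (T t))
    (hbdd : ∃ M : ℝ, ∀ t ≥ (0:ℝ), ‖T t‖ ≤ M)
    (hcont : ∀ x : H, ContinuousWithinAt (fun t => T t x) (Set.Ici 0) 0)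
    -- `A` is the generator of `(T(t))`
    (hgen : ∀ (x : H), (∃ hx : x ∈ A.domain, Tendsto (fun t : ℝ => t⁻¹ • (T t x - x))
        (nhdsWithin 0 (Set.Ioi 0)) (nhds (A ⟨x, hx⟩))) ↔
      ∃ y : H, Tendsto (fun t : ℝ => t⁻¹ • (T t x - x)) (nhdsWithin 0 (Set.Ioi 0)) (nhds y))
    -- `σ(A) ∩ iℝ = {0}`: every nonzero `is` is in the resolvent set
    (himres : ∀ s : ℝ, s ≠ 0 → ∃ R : H →L[ℂ] H, IsResolventAt A (Complex.I * s) R)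
    -- `1 ∈ ρ(A)`, with resolvent `R1 = (I − A)⁻¹`
    (R1 : H →L[ℂ] H) (hR1 : IsResolventAt A 1 R1)
    (l k : ℝ) (hl : 1 ≤ l) (hk : 0 < k)
    -- `‖(is − A)⁻¹‖ = O(|s|^{−l})` as `s → 0`
    (hres0 : ∃ C₁ > (0:ℝ), ∃ δ > (0:ℝ), ∀ s : ℝ, s ≠ 0 → |s| < δ →
      ∀ R : H →L[ℂ] H, IsResolventAt A (Complex.I * s) R → ‖R‖ ≤ C₁ * |s| ^ (-l))
    -- `‖(is − A)⁻¹‖ = O(|s|^k)` as `|s| → ∞`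
    (hresInf : ∃ C₂ > (0:ℝ), ∃ Λ : ℝ, ∀ s : ℝ, Λ ≤ |s| →
      ∀ R : H →L[ℂ] H, IsResolventAt A (Complex.I * s) R → ‖R‖ ≤ C₂ * |s| ^ k) :
    ∃ C > (0:ℝ), ∀ t ≥ (1:ℝ),
      ‖(T t).comp (R1.comp R1 - R1)‖ ≤ C * t ^ (-(1 / max l k)) := by
  obtain ⟨M₀, hM₀⟩ := hbdd
  have h : BctSemi T (max M₀ 1) :=
    ⟨hsemi0, hsemi, le_max_right _ _, fun t ht => (hM₀ t ht).trans (le_max_left _ _), hcont⟩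
  set M := max M₀ 1 with hMdef
  have hM := h.one_le
  obtain ⟨L, hL'⟩ := h.exists_laplace
  have hL : BctLap T L := fun z hz => (hL' z hz).2
  have hn : ∀ z : ℂ, 0 < z.re → ‖L z‖ ≤ M / z.re := fun z hz => (hL' z hz).1
  obtain ⟨hR1L, hres⟩ := hL.isResolvent h A hgen R1 hR1
  have hid : ∀ z w : ℂ, 0 < z.re → 0 < w.re → ∀ x, L z x - L w x = (w - z) • L z (L w x) :=
    fun z w hz hw x => (hres z hz).identity (hres w hw) x
  obtain ⟨C₃, hC₃, hb⟩ := bct_imag_bound himres l k hres0 hresInf hl hk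
  set a := max l k with hadef
  have ha : 1 ≤ a := hl.trans (le_max_left _ _)
  have hb' := bct_right_bound hM hn hres himres ha hC₃ hb
  obtain ⟨C, hC, hlarge⟩ := bct_large h hL hn hid ha (by positivity) hb'
  have hB : ‖L 1 - L 1 * L 1‖ ≤ M + M * M := by
    have h1 : ‖L 1‖ ≤ M := by simpa using hn 1 (by simp)
    calc ‖L 1 - L 1 * L 1‖ ≤ ‖L 1‖ + ‖L 1 * L 1‖ := norm_sub_le _ _
      _ ≤ ‖L 1‖ + ‖L 1‖ * ‖L 1‖ := by gcongr; exact norm_mul_le _ _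
      _ ≤ M + M * M := by gcongr
  refine ⟨C + 4 * (M * (M + M * M)), by positivity, ?_⟩
  intro t ht
  have ht0 : 0 < t := by linarith
  have e : (T t).comp (R1.comp R1 - R1) = -((T t).comp (L 1 - L 1 * L 1)) := by
    rw [hR1L, ← ContinuousLinearMap.comp_neg, neg_sub]
    rfl
  rw [e, norm_neg]
  have hp : 0 < t ^ (-(1 / a)) := Real.rpow_pos_of_pos ht0 _
  have hX : 0 ≤ M * (M + M * M) := by positivity
  rcases le_or_gt 4 (t ^ (1 / a)) with h4 | h4
  · refine (hlarge t h4 ht).trans ?_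
    gcongr
    linarith
  · have h5 : 1 ≤ 4 * t ^ (-(1 / a)) := by
      rw [Real.rpow_neg ht0.le, ← div_eq_mul_inv, le_div_iff₀ (Real.rpow_pos_of_pos ht0 _)]
      linarith
    calc ‖(T t).comp (L 1 - L 1 * L 1)‖ ≤ ‖T t‖ * ‖L 1 - L 1 * L 1‖ :=
          ContinuousLinearMap.opNorm_comp_le _ _
      _ ≤ M * (M + M * M) := by
          gcongr
          exact h.bdd t ht0.le
      _ ≤ M * (M + M * M) * (4 * t ^ (-(1 / a))) := le_mul_of_one_le_right hX h5
      _ ≤ (C + 4 * (M * (M + M * M))) * t ^ (-(1 / a)) := by nlinarith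
end
end

section
/- Consider the quartic polynomial f(λ) = (μ^γ + 1)λ⁴ + (μ^γ + 1)λ³ + (μ^{2α} + μ^{β+γ} + 2μ + μ^β)λ² + (μ^{2α} + 2μ)λ + 2μ^{1+β}, where α, β ∈ [0,1], γ ∈ (0,1], α > (β+1)/2, and μ > 0. Then as μ → ∞, f has a complex conjugate pair of roots λ_{1,2}(μ) = −(1/2)μ^{−2α+β+γ}(1 + o(1)) ± i μ^{α−γ/2}(1 + o(1)), a real root λ₃(μ) = −2μ^{−2α+β+1}(1 + o(1)), and a real root λ₄(μ) = −(1 + o(1)). -/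
open Complex

noncomputable section

/-- The characteristic quartic of the thermoelastic system with inertial term
(`m = 1`, `σ = 2`, `τ = 1`) on the eigenspace of `A` with eigenvalue `μ`. -/
def quarticInertia (α β γ μ : ℝ) (z : ℂ) : ℂ :=
  ((μ ^ γ + 1 : ℝ) : ℂ) * z ^ 4 + ((μ ^ γ + 1 : ℝ) : ℂ) * z ^ 3
    + ((μ ^ (2 * α) + μ ^ (β + γ) + 2 * μ + μ ^ β : ℝ) : ℂ) * z ^ 2
    + ((μ ^ (2 * α) + 2 * μ : ℝ) : ℂ) * z + ((2 * μ ^ (1 + β) : ℝ) : ℂ)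

lemma core_ivt_aux (B C D p q : ℝ) (hpq : p ≤ q)
    (hp : 0 ≤ p^4+p^3+(C+B)*p^2+C*p+D) (hq : q^4+q^3+(C+B)*q^2+C*q+D ≤ 0) :
    ∃ l, p ≤ l ∧ l ≤ q ∧ l^4+l^3+(C+B)*l^2+C*l+D = 0 := by
  have := intermediate_value_Icc' hpq
    (f := fun l : ℝ => l^4+l^3+(C+B)*l^2+C*l+D) (by fun_prop)
  obtain ⟨l, hl, h⟩ := this ⟨hq, hp⟩
  exact ⟨l, hl.1, hl.2, h⟩

lemma core_ivt_aux' (B C D p q : ℝ) (hpq : p ≤ q)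
    (hp : p^4+p^3+(C+B)*p^2+C*p+D ≤ 0) (hq : 0 ≤ q^4+q^3+(C+B)*q^2+C*q+D) :
    ∃ l, p ≤ l ∧ l ≤ q ∧ l^4+l^3+(C+B)*l^2+C*l+D = 0 := by
  have := intermediate_value_Icc hpq
    (f := fun l : ℝ => l^4+l^3+(C+B)*l^2+C*l+D) (by fun_prop)
  obtain ⟨l, hl, h⟩ := this ⟨hp, hq⟩
  exact ⟨l, hl.1, hl.2, h⟩

set_option maxHeartbeats 1000000 in
/-- Quantitative root localisation for the normalised quartic. -/
lemma core_roots (ε δ B C q : ℝ) (hε : 0 < ε) (hε1 : ε ≤ 1/4) (hδ : δ = ε/100)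
    (hB : 1 ≤ B) (hC : 1 ≤ δ * C) (hBC : B ≤ δ * C) (hq : 0 < q) (hqδ : q ≤ δ) :
    ∃ l3 l4 y w : ℝ, y = 1 + l3 + l4 ∧
      l3 * l4 + (w^2+y^2/4) + y*(1-y) = C + B ∧
      (1-y)*(w^2+y^2/4) + y*(l3*l4) = C ∧
      l3*l4*(w^2+y^2/4) = q*C ∧
      |l3 - (-q)| ≤ ε*q ∧ |l4 - (-1)| ≤ ε ∧ |y - B/C| ≤ ε*(B/C) ∧
      |w - √C| ≤ ε * √C := by
  have hδ0 : 0 < δ := by linarith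
  have hC0 : 0 < C := by
    by_contra h
    push Not at h
    nlinarith
  have hC1 : 100 ≤ C := by nlinarith
  -- root near zero
  obtain ⟨l3, h3a, h3b, h3⟩ : ∃ l, -(1+ε)*q ≤ l ∧ l ≤ -(1-ε)*q ∧
      l^4+l^3+(C+B)*l^2+C*l+q*C = 0 := by
    apply core_ivt_aux'
    · nlinarith
    · set h := (1+ε)*q with hh
      have e : -(1+ε)*q = -h := by rw [hh]; ring
      rw [e]
      have hpos : 0 < h := by positivity
      have h2 : h ≤ 2*q := by nlinarith
      have hlt : h ≤ 1 := by nlinarith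
      have h3 : h^4 ≤ h^3 := by nlinarith [pow_pos hpos 3]
      have h4 : h^2 ≤ 4*δ*q := by nlinarith
      have h5 : (C+B)*h^2 ≤ (2*C)*(4*δ*q) := by
        apply mul_le_mul _ h4 (by positivity) (by positivity)
        nlinarith
      have h6 : (2*C)*(4*δ*q) ≤ C*(ε*q) := by
        rw [hδ]; nlinarith [mul_pos hC0 (mul_pos hε hq)]
      have h7 : C * h = C*q + C*(ε*q) := by rw [hh]; ring
      nlinarith
    · set h := (1-ε)*q with hh
      have e : -(1-ε)*q = -h := by rw [hh]; ring
      rw [e]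
      have hpos : 0 < h := mul_pos (by linarith) hq
      have h2 : h ≤ q := by nlinarith
      have hlt : h ≤ 1 := by nlinarith
      have h3 : h^3 ≤ h^2 := by nlinarith [pow_pos hpos 2]
      have h7 : C * h = C*q - C*(ε*q) := by rw [hh]; ring
      have h8 : 0 < C*(ε*q) := by positivity
      nlinarith [pow_pos hpos 4, pow_pos hpos 2]
  obtain ⟨l4, h4a, h4b, h4⟩ : ∃ l, -1 ≤ l ∧ l ≤ -1+ε ∧
      l^4+l^3+(C+B)*l^2+C*l+q*C = 0 := by
    apply core_ivt_aux
    · linarith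
    · nlinarith
    · have e : (-1+ε)^4+(-1+ε)^3+(C+B)*(-1+ε)^2+C*(-1+ε)+q*C
          = -(1-ε)^3*ε - C*(ε*(1-ε)) + B*(1-ε)^2 + q*C := by ring
      rw [e]
      have h1 : 0 < (1-ε)^3*ε := mul_pos (pow_pos (by linarith) 3) hε
      have h2 : B*(1-ε)^2 ≤ B := by nlinarith
      have h3 : q*C ≤ δ*C := by nlinarith
      have h4 : C*(ε*(1/2)) ≤ C*(ε*(1-ε)) := by
        apply mul_le_mul_of_nonneg_left _ hC0.le
        apply mul_le_mul_of_nonneg_left _ hε.le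
        linarith
      rw [hδ] at h3 hBC
      nlinarith [mul_pos hε hC0]
  have hq1 : q ≤ 1/400 := by linarith
  have h3c : -(2*q) ≤ l3 := by nlinarith
  have h3d : l3 ≤ 0 := by nlinarith
  have hne : l3 - l4 ≠ 0 := by
    have : 0 < l3 - l4 := by linarith
    exact this.ne'
  obtain ⟨y, hy⟩ : ∃ y, y = 1 + l3 + l4 := ⟨_, rfl⟩
  obtain ⟨t, ht⟩ : ∃ t, t = l3*l4 := ⟨_, rfl⟩
  obtain ⟨r, hr⟩ : ∃ r, r = C + B - t - y*(1-y) := ⟨_, rfl⟩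
  have E1 : (1-y)*r + y*t = C := by
    apply mul_left_cancel₀ hne
    rw [hr, ht, hy]
    linear_combination h4 - h3
  have E0 : t*r = q*C := by
    apply mul_left_cancel₀ hne
    rw [hr, ht, hy]
    linear_combination l4*h3 - l3*h4
  have hy1 : y ≤ 1/4 := by linarith
  have hy0 : -(1/200) ≤ y := by linarith
  have ht0 : 0 ≤ t := by rw [ht]; exact mul_nonneg_of_nonpos_of_nonpos h3d (by linarith)
  have ht1 : t ≤ 2*q := by
    have : (-l3)*(-l4) ≤ (-l3)*1 := mul_le_mul_of_nonneg_left (by linarith) (by linarith)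
    rw [ht]; linarith
  have hy2 : y^2 ≤ 1 := by
    rw [sq_le_one_iff_abs_le_one, abs_le]; constructor <;> linarith
  have hyy : y*(1-y) ≤ 1 := by
    linarith [sq_nonneg y, show y*(1-y) = y - y^2 by ring]
  have hyy' : -1 - 1/200 ≤ y*(1-y) := by
    linarith [show y*(1-y) = y - y^2 by ring]
  have hr1 : r ≤ C + 3*(δ*C) := by linarith
  have hr0 : C - 2*(δ*C) ≤ r := by linarith
  have hCC : δ*C ≤ C/400 := by
    have : δ*C ≤ (1/400)*C := mul_le_mul_of_nonneg_right (by linarith) hC0.le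
    linarith
  have hw0 : 0 ≤ r - y^2/4 := by linarith
  have hw := Real.sq_sqrt hw0
  set w := √(r - y^2/4) with hwdef
  have hwn : 0 ≤ w := Real.sqrt_nonneg _
  have hrw : w^2+y^2/4 = r := by linarith
  have E2 : y*(r - t + 1 - y) = B - t := by
    rw [hr] at E1 ⊢
    linear_combination -E1
  have hden1 : r - t + 1 - y ≤ C + 4*(δ*C) := by linarith
  have hden0 : C - 4*(δ*C) ≤ r - t + 1 - y := by linarith
  have hεC : 100*(δ*C) = ε*C := by rw [hδ]; ring
  have htB : t ≤ 2*δ*B := by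
    have : δ*1 ≤ δ*B := mul_le_mul_of_nonneg_left hB hδ0.le
    linarith
  refine ⟨l3, l4, y, w, hy, ?_, ?_, ?_, ?_, ?_, ?_, ?_⟩
  · rw [hrw, hr, ht]; ring
  · rw [hrw, ← ht]; exact E1
  · rw [hrw, ← ht]; exact E0
  · rw [abs_le]; constructor <;> linarith
  · rw [abs_le]; constructor <;> linarith
  · have hypos : 0 ≤ y := by
      by_contra h
      push Not at h
      have : y*(r - t + 1 - y) < 0 := mul_neg_of_neg_of_pos h (by linarith)
      have : 2*δ*B ≤ 1*B := mul_le_mul_of_nonneg_right (by linarith) (by linarith)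
      linarith
    have u1 : y*C*(1-4*δ) ≤ B := by
      have : y*(C-4*(δ*C)) ≤ y*(r - t + 1 - y) := mul_le_mul_of_nonneg_left hden0 hypos
      linarith
    have u2 : B*(1-2*δ) ≤ y*C*(1+4*δ) := by
      have : y*(r - t + 1 - y) ≤ y*(C+4*(δ*C)) := mul_le_mul_of_nonneg_left hden1 hypos
      linarith
    have key : |y*C - B| ≤ ε*B := by
      have hyC : 0 ≤ y*C := by positivity
      have hδs : δ ≤ 1/400 := by linarith
      have hyC2 : y*C ≤ 2*B := by
        have : y*C*δ ≤ y*C*(1/400) := mul_le_mul_of_nonneg_left hδs hyC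
        linarith
      have p1 : δ*(y*C) ≤ δ*(2*B) := mul_le_mul_of_nonneg_left hyC2 hδ0.le
      have p2 : 0 ≤ δ*B := by positivity
      have p3 : ε*B = 100*(δ*B) := by rw [hδ]; ring
      rw [abs_le]; constructor <;> linarith
    have e1 : y - B/C = (y*C-B)/C := by field_simp
    rw [e1, abs_div, abs_of_pos hC0, ← mul_div_assoc]
    gcongr
  · have hs := Real.sq_sqrt hC0.le
    have hs0 : 0 < √C := Real.sqrt_pos.2 hC0
    have hk : |w^2 - C| ≤ ε*C := by
      rw [abs_le]; constructor <;> linarith [sq_nonneg y]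
    have hm : |w - √C| * √C ≤ (ε*√C)*√C := by
      calc |w - √C| * √C ≤ |w - √C| * (w + √C) := by gcongr; linarith
        _ = |w^2 - C| := by
            rw [← abs_of_nonneg (show 0 ≤ w + √C by positivity), ← abs_mul]
            congr 1
            linear_combination -hs
        _ ≤ ε*C := hk
        _ = _ := by linear_combination -ε*hs
    exact le_of_mul_le_mul_right hm hs0

lemma rel_trans_aux (η ε x X X0 : ℝ) (hη : 0 < η) (h1 : η ≤ 1) (h3 : 3*η ≤ ε) (hX0 : 0 ≤ X0)
    (hx : |x - X| ≤ η*X) (hX : |X - X0| ≤ η*X0) : |x - X0| ≤ ε*X0 := by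
  rw [abs_le] at *
  have : η*X ≤ 2*η*X0 := by nlinarith
  constructor <;> nlinarith

lemma rel_of_ratio_aux (η ρ X X0 : ℝ) (hX0 : 0 ≤ X0) (h : X = X0*ρ) (hρ : |ρ - 1| ≤ η) :
    |X - X0| ≤ η*X0 := by
  have : X - X0 = (ρ-1)*X0 := by rw [h]; ring
  rw [this, abs_mul, abs_of_nonneg hX0]
  gcongr

open Filter Topology in
lemma ev_ratio_aux (f : ℝ → ℝ) (η : ℝ) (hη : 0 < η) (h : Tendsto f atTop (𝓝 1)) :
    ∀ᶠ μ in atTop, |f μ - 1| ≤ η := by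
  filter_upwards [(Metric.tendsto_nhds.1 h) η hη] with μ hμ
  rw [Real.dist_eq] at hμ
  exact hμ.le

open Filter Topology in
/-- For `α, β ∈ [0,1]`, `γ ∈ (0,1]`, `α > (β+1)/2`, as `μ → ∞` the
quartic `(μ^γ+1)λ⁴ + (μ^γ+1)λ³ + (μ^{2α}+μ^{β+γ}+2μ+μ^β)λ² + (μ^{2α}+2μ)λ + 2μ^{1+β}`
has a complex conjugate pair of roots
`λ_{1,2} = −(1/2)μ^{−2α+β+γ}(1+o(1)) ± iμ^{α−γ/2}(1+o(1))`, a real root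
`λ₃ = −2μ^{−2α+β+1}(1+o(1))`, and a real root `λ₄ = −(1+o(1))`. -/
theorem quartic_roots_inertia (α β γ : ℝ)
    (hα : α ∈ Set.Icc (0:ℝ) 1) (hβ : β ∈ Set.Icc (0:ℝ) 1) (hγ : γ ∈ Set.Ioc (0:ℝ) 1)
    (hQ : (β + 1) / 2 < α) :
    ∀ ε > (0:ℝ), ∃ M : ℝ, ∀ μ : ℝ, M < μ →
      ∃ l1 l3 l4 : ℂ,
        quarticInertia α β γ μ l1 = 0 ∧
        quarticInertia α β γ μ (starRingEnd ℂ l1) = 0 ∧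
        quarticInertia α β γ μ l3 = 0 ∧
        quarticInertia α β γ μ l4 = 0 ∧
        -- `λ₁ = −(1/2)μ^{−2α+β+γ}(1+o(1)) + iμ^{α−γ/2}(1+o(1))`, `λ₂ = conj λ₁`
        |l1.re - (-(1 / 2) * μ ^ (-(2 * α) + β + γ))|
          ≤ ε * ((1 / 2) * μ ^ (-(2 * α) + β + γ)) ∧
        |l1.im - μ ^ (α - γ / 2)| ≤ ε * μ ^ (α - γ / 2) ∧
        -- `λ₃ = −2μ^{−2α+β+1}(1+o(1))` is real
        l3.im = 0 ∧
        |l3.re - (-2 * μ ^ (-(2 * α) + β + 1))| ≤ ε * (2 * μ ^ (-(2 * α) + β + 1)) ∧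
        -- `λ₄ = −(1+o(1))` is real
        l4.im = 0 ∧ |l4.re - (-1)| ≤ ε := by
  intro ε hε
  obtain ⟨hγ0, hγ1⟩ := hγ
  obtain ⟨hβ0, hβ1⟩ := hβ
  obtain ⟨η, hη⟩ : ∃ η, η = min (ε/3) (1/4) := ⟨_, rfl⟩
  have hη0 : 0 < η := by rw [hη]; positivity
  have hη1 : η ≤ 1/4 := by rw [hη]; exact min_le_right _ _
  have hη3 : 3*η ≤ ε := by
    have : η ≤ ε/3 := by rw [hη]; exact min_le_left _ _
    linarith
  have hu : Tendsto (fun μ : ℝ => μ ^ (-γ)) atTop (𝓝 0) := tendsto_rpow_neg_atTop hγ0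
  have hv : Tendsto (fun μ : ℝ => μ ^ (1-2*α)) atTop (𝓝 0) := by
    have := tendsto_rpow_neg_atTop (y := 2*α-1) (by linarith)
    simpa using this
  have hR : Tendsto (fun μ : ℝ => μ ^ (-(2*α)+β+γ)) atTop (𝓝 0) := by
    have := tendsto_rpow_neg_atTop (y := 2*α-β-γ) (by linarith)
    convert this using 3; ring
  have hQ' : Tendsto (fun μ : ℝ => μ ^ (-(2*α)+β+1)) atTop (𝓝 0) := by
    have := tendsto_rpow_neg_atTop (y := 2*α-β-1) (by linarith)
    convert this using 3; ring
  have hP : Tendsto (fun μ : ℝ => μ ^ (2*α-γ)) atTop atTop := tendsto_rpow_atTop (by linarith)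
  have h1u : Tendsto (fun μ : ℝ => 1 + μ ^ (-γ)) atTop (𝓝 1) := by simpa using hu.const_add 1
  have h1v : Tendsto (fun μ : ℝ => 1 + 2*μ ^ (1-2*α)) atTop (𝓝 1) := by
    simpa using (hv.const_mul 2).const_add 1
  have hρ : Tendsto (fun μ : ℝ => (1 + 2*μ ^ (1-2*α))/(1 + μ ^ (-γ))) atTop (𝓝 1) := by
    have := h1v.div h1u one_ne_zero
    rw [div_one] at this; exact this
  have hρi : Tendsto (fun μ : ℝ => (1 + μ ^ (-γ))/(1 + 2*μ ^ (1-2*α))) atTop (𝓝 1) := by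
    have := h1u.div h1v one_ne_zero
    rw [div_one] at this; exact this
  have hρq : Tendsto (fun μ : ℝ => 1/(1 + 2*μ ^ (1-2*α))) atTop (𝓝 1) := by
    have := (tendsto_const_nhds (x := (1:ℝ))).div h1v one_ne_zero
    rw [div_one] at this; exact this
  have hρs : Tendsto (fun μ : ℝ => √((1 + 2*μ ^ (1-2*α))/(1 + μ ^ (-γ)))) atTop (𝓝 1) := by
    simpa using hρ.sqrt
  have hCt : Tendsto (fun μ : ℝ => μ ^ (2*α-γ) * ((1 + 2*μ ^ (1-2*α))/(1 + μ ^ (-γ))))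
      atTop atTop := hP.atTop_mul_pos one_pos hρ
  have hBCt : Tendsto (fun μ : ℝ => μ ^ (-(2*α)+β+γ) * ((1 + μ ^ (-γ))/(1 + 2*μ ^ (1-2*α))))
      atTop (𝓝 0) := by simpa using hR.mul hρi
  have hqt : Tendsto (fun μ : ℝ => (2*μ ^ (-(2*α)+β+1)) * (1/(1 + 2*μ ^ (1-2*α))))
      atTop (𝓝 0) := by simpa using (hQ'.const_mul 2).mul hρq
  have hδ0 : 0 < η/100 := by positivity
  have hall := (((((eventually_gt_atTop (1:ℝ)).and (hCt.eventually_ge_atTop (1/(η/100)))).and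
    ((hBCt.eventually_le_const hδ0).and (hqt.eventually_le_const hδ0))).and
    ((ev_ratio_aux _ η hη0 hρi).and (ev_ratio_aux _ η hη0 hρq))).and
    (ev_ratio_aux _ η hη0 hρs))
  obtain ⟨M, hM⟩ := eventually_atTop.1 hall
  refine ⟨M, fun μ hμ => ?_⟩
  obtain ⟨⟨⟨⟨hμ1, e1⟩, e2, e3⟩, e4, e5⟩, e6⟩ := hM μ hμ.le
  have hμ0 : 0 < μ := by linarith
  obtain ⟨u, hu⟩ : ∃ u, u = μ ^ (-γ) := ⟨_, rfl⟩
  obtain ⟨v, hv⟩ : ∃ v, v = μ ^ (1-2*α) := ⟨_, rfl⟩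
  have hu0 : 0 < u := by rw [hu]; positivity
  have hv0 : 0 < v := by rw [hv]; positivity
  rw [← hu, ← hv] at e4
  rw [← hu, ← hv] at e1 e2 e6
  rw [← hv] at e3 e5
  obtain ⟨C, hC⟩ : ∃ C, C = μ ^ (2*α-γ) * ((1 + 2*v)/(1 + u)) := ⟨_, rfl⟩
  obtain ⟨q, hq⟩ : ∃ q, q = (2*μ ^ (-(2*α)+β+1)) * (1/(1 + 2*v)) := ⟨_, rfl⟩
  have hC0 : 0 < C := by rw [hC]; positivity
  have hq0 : 0 < q := by rw [hq]; positivity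
  have hB1 : 1 ≤ μ ^ β := Real.one_le_rpow hμ1.le hβ0
  have hBC : μ ^ β / C = μ ^ (-(2*α)+β+γ) * ((1 + u)/(1 + 2*v)) := by
    have : μ ^ β = μ ^ (-(2*α)+β+γ) * μ ^ (2*α-γ) := by
      rw [← Real.rpow_add hμ0]; congr 1; ring
    rw [hC, this]
    field_simp
  rw [← hC] at e1
  rw [← hBC] at e2
  rw [← hq] at e3
  have hCδ : 1 ≤ η/100*C := by
    rw [div_le_iff₀ hδ0] at e1; linarith
  have hBδ : μ ^ β ≤ η/100*C := by rwa [div_le_iff₀ hC0] at e2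
  obtain ⟨l3, l4, y, w, hy, k2, k1, k0, r3, r4, ry, rw'⟩ :=
    core_roots η (η/100) (μ^β) C q hη0 hη1 rfl hB1 hCδ hBδ hq0 e3
  -- relation of coefficients
  have ha : μ ^ γ + 1 = μ^γ*(1+u) := by
    rw [hu, mul_add, ← Real.rpow_add hμ0]; simp
  have hc : μ ^ (2*α) + 2*μ = μ ^ (2*α)*(1+2*v) := by
    have : μ ^ (2*α) * v = μ := by
      rw [hv, ← Real.rpow_add hμ0]
      rw [show 2*α + (1-2*α) = 1 by ring, Real.rpow_one]
    linear_combination -2*this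
  have hcC : μ ^ (2*α) + 2*μ = (μ^γ+1)*C := by
    have : μ ^ (2*α) = μ^γ * μ ^ (2*α-γ) := by
      rw [← Real.rpow_add hμ0]; congr 1; ring
    rw [hc, ha, hC, this]
    field_simp
  have hb : μ ^ (2 * α) + μ ^ (β + γ) + 2 * μ + μ ^ β = (μ^γ+1)*(C+μ^β) := by
    rw [Real.rpow_add hμ0]
    linear_combination hcC
  have hd : 2*μ^(1+β) = (μ^γ+1)*(q*C) := by
    have : μ ^ (1+β) = μ ^ (-(2*α)+β+1) * μ ^ (2*α) := by
      rw [← Real.rpow_add hμ0]; congr 1; ring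
    calc 2*μ^(1+β) = q * (μ ^ (2*α)*(1+2*v)) := by rw [hq, this]; field_simp
      _ = q * ((μ^γ+1)*C) := by rw [← hc, hcC]
      _ = _ := by ring
  have hfac : ∀ z : ℂ, quarticInertia α β γ μ z =
      ((μ^γ+1 : ℝ) : ℂ) * ((z - l3)*(z-l4)*((z + y/2)^2 + w^2)) := by
    intro z
    rw [quarticInertia, hb, hcC, hd, ← k0]
    have k2' := congrArg (fun x : ℝ => (x : ℂ)) k2
    have k1' := congrArg (fun x : ℝ => (x : ℂ)) k1
    have hy' := congrArg (fun x : ℝ => (x : ℂ)) hy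
    push_cast at k2' k1' hy' ⊢
    rw [← k2', ← k1', hy']
    ring
  have hI : (I:ℂ)^2 = -1 := I_sq
  refine ⟨((-y/2 : ℝ) : ℂ) + (w:ℂ)*I, l3, l4, ?_, ?_, ?_, ?_, ?_, ?_, ?_, ?_, ?_, ?_⟩
  · rw [hfac]; push_cast
    rw [show ((-y/2 + w*I + y/2)^2 + w^2 : ℂ) = 0 by linear_combination (w:ℂ)^2*hI]; simp
  · rw [hfac]
    simp only [map_add, map_mul, conj_ofReal, conj_I]; push_cast
    rw [show ((-y/2 + w*(-I) + y/2)^2 + w^2 : ℂ) = 0 by linear_combination (w:ℂ)^2*hI]; simp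
  · rw [hfac]; simp
  · rw [hfac]; simp
  · have := rel_trans_aux η ε y _ _ hη0 (by linarith) hη3 (by positivity) ry
      (rel_of_ratio_aux η _ _ _ (by positivity) hBC e4)
    simp only [add_re, ofReal_re, mul_re, I_re, ofReal_im, I_im]
    rw [abs_le] at *
    constructor <;> linarith
  · have hs : √C = μ ^ (α-γ/2) * √((1 + 2*v)/(1 + u)) := by
      rw [hC, Real.sqrt_mul (by positivity)]
      congr 1
      rw [Real.sqrt_eq_rpow, ← Real.rpow_mul hμ0.le]
      congr 1; ring
    have := rel_trans_aux η ε w _ _ hη0 (by linarith) hη3 (by positivity) rw'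
      (rel_of_ratio_aux η _ _ _ (by positivity) hs e6)
    simpa using this
  · simp
  · have hr : |-l3 - q| ≤ η*q := by
      rw [abs_le] at *
      constructor <;> linarith
    have := rel_trans_aux η ε (-l3) _ _ hη0 (by linarith) hη3 (by positivity) hr
      (rel_of_ratio_aux η _ _ _ (by positivity) hq e5)
    rw [ofReal_re]
    rw [abs_le] at *
    constructor <;> linarith
  · simp
  · rw [ofReal_re]; linarith
end
end
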